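/- Let G = ℝ^{n+1} be a Grushin space of homogeneous dimension Q = n+2 with Q ≥ 4, and let B_R^Q(o) be the gauge ball of radius R > 0. Let 1 < p < ∞, a < Q, p ≤ b < ∞, c > 0, and a ≤ Q − (b−1)c. Then for any u ∈ C_0^∞(B_R^Q(o)): ∫_{B_R^Q(o)} |∇_{ϱ,G} u|^p / ( ϱ^{a−p} (1 − (ϱ/R)^c)^{b−p} ) dx dt ≥ ( (b−1)c/p )^p ∫_{B_R^Q(o)} |u|^p ψ^{p/2} / ( ϱ^{a} (1 − (ϱ/R)^c)^{b} ) dx dt, and the constant ((b−1)c/p)^p is sharp. -/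

import Mathlib

open MeasureTheory Real

noncomputable section

/-- Points of the Grushin space `ℝ^{n+1}`. -/
abbrev GPt (n : ℕ) := EuclideanSpace ℝ (Fin n) × ℝ

/-- Homogeneous Grushin norm `ϱ(x,t) = (|x|⁴ + 4t²)^{1/4}`. -/
def gNorm {n : ℕ} (z : GPt n) : ℝ := (‖z.1‖ ^ 4 + 4 * z.2 ^ 2) ^ ((1 : ℝ) / 4)

/-- The geometric term `ψ(x,t) = |x|²/ϱ²` (so that `|∇_G ϱ| = ψ^{1/2}`). -/
def gPsi {n : ℕ} (z : GPt n) : ℝ := ‖z.1‖ ^ 2 / gNorm z ^ 2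

/-- Radial derivative `∂_ϱ u(x,t) = d/ds u(s·x/ϱ, s²·t/ϱ²)` at `s = ϱ(x,t)`. -/
def radialDeriv {n : ℕ} (u : GPt n → ℝ) (z : GPt n) : ℝ :=
  deriv (fun s : ℝ => u ((s / gNorm z) • z.1, (s ^ 2 / gNorm z ^ 2) * z.2)) (gNorm z)

/-- The scaled function `u_R(x,t) = u(R·x/ϱ, R²·t/ϱ²)`. -/
def uScaled {n : ℕ} (R : ℝ) (u : GPt n → ℝ) (z : GPt n) : ℝ :=
  u ((R / gNorm z) • z.1, (R ^ 2 / gNorm z ^ 2) * z.2)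

/-- Radial Grushin operator `L_{ϱ,G} u = ψ(∂_ϱ² u + ((Q−1)/ϱ) ∂_ϱ u)`. -/
def radialLap {n : ℕ} (Q : ℝ) (u : GPt n → ℝ) (z : GPt n) : ℝ :=
  gPsi z * (radialDeriv (radialDeriv u) z + (Q - 1) / gNorm z * radialDeriv u z)

/-- The Grushin operator `L_G u = Δ_x u + |x|² ∂_t² u`. -/
def grushinOp {n : ℕ} (u : GPt n → ℝ) (z : GPt n) : ℝ :=
  (∑ i : Fin n,
      deriv (deriv fun s : ℝ => u (z.1 + s • EuclideanSpace.single i (1 : ℝ), z.2)) 0)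
    + ‖z.1‖ ^ 2 * deriv (deriv fun s : ℝ => u (z.1, z.2 + s)) 0

/-- The first-order operator `T_β(u) = ψ^{1/2}(∂_ϱ u + ((Q−β−2)/(2ϱ)) u)`. -/
def Tweight {n : ℕ} (Q β : ℝ) (u : GPt n → ℝ) (z : GPt n) : ℝ :=
  Real.sqrt (gPsi z) * (radialDeriv u z + (Q - β - 2) / (2 * gNorm z) * u z)

/-- The iterated operator `R_{β,k} = T_β ∘ T_{β+2} ∘ ⋯ ∘ T_{β+2k}`. -/
def Rop {n : ℕ} (Q : ℝ) : ℕ → ℝ → (GPt n → ℝ) → GPt n → ℝ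
  | 0, β, u => Tweight Q β u
  | k + 1, β, u => Tweight Q β (Rop Q k (β + 2) u)

/-- The constants `Λ_k(Q,p,β)`. -/
def Lam (Q p β : ℝ) (k : ℕ) : ℝ :=
  if k = 1 then ((Q - p - β) / p) ^ p
  else ((Q * (p - 1) + β + ((k : ℝ) - 2) * p) * (Q - β - (k : ℝ) * p) / p ^ 2) ^ p

/-- The constant `C_{2l,p,β} = ∏_{i=1}^{l} Λ_{2i}(Q,p,β)`. -/
def Ceven (Q p β : ℝ) (l : ℕ) : ℝ := ∏ i ∈ Finset.range l, Lam Q p β (2 * i + 2)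

/-- The constant `C_{2l+1,p,β} = ∏_{i=0}^{l} Λ_{2i+1}(Q,p,β)`. -/
def Codd (Q p β : ℝ) (l : ℕ) : ℝ := ∏ i ∈ Finset.range (l + 1), Lam Q p β (2 * i + 1)

/-- The constant `A_m = ((Q+m)² + (Q−4−m)²)/4`. -/
def Aconst (Q m : ℝ) : ℝ := ((Q + m) ^ 2 + (Q - 4 - m) ^ 2) / 4

/-- The constants `D_{j,m,β}` given by the iteration
`D_{j,m+1,β} = Λ_{2m+2}(Q,2,β) D_{j−2,m,β} + A_{β+4m} D_{j−1,m,β} + D_{j,m,β}`,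
with `D_{0,0,β} = 1` (and vanishing off-range values). -/
def Dconst (Q β : ℝ) : ℕ → ℤ → ℝ
  | 0, j => if j = 0 then 1 else 0
  | m + 1, j =>
      Lam Q 2 β (2 * m + 2) * Dconst Q β m (j - 2)
        + Aconst Q (β + 4 * (m : ℝ)) * Dconst Q β m (j - 1) + Dconst Q β m j

/-- The constants `B_{j,m,β,k}` given by the iteration
`B_{j,m+1,β,k} = Λ_2(Q,2,β+2k+2) B_{j−2,m,β+4,k} + A_{β+2k+2} B_{j−1,m,β+2,k+1} + B_{j,m,β,k+2}`,
with `B_{0,0,β,k} = 1` (and vanishing off-range values). -/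
def Bconst (Q : ℝ) : ℕ → ℤ → ℝ → ℝ → ℝ
  | 0, j, _, _ => if j = 0 then 1 else 0
  | m + 1, j, β, k =>
      Lam Q 2 (β + 2 * k + 2) 2 * Bconst Q m (j - 2) (β + 4) k
        + Aconst Q (β + 2 * k + 2) * Bconst Q m (j - 1) (β + 2) (k + 1)
        + Bconst Q m j β (k + 2)

/-- Surface measure `ω_n` of the unit sphere in `ℝ^n`. -/
def sphSurface (n : ℕ) : ℝ :=
  n * (volume (Metric.ball (0 : EuclideanSpace ℝ (Fin n)) 1)).toReal

/-- The integral constant `C^{Ω,m} = ω_n ∫_0^π (sin φ)^{(n+m)/2} dφ`. -/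
def COmega (n m : ℕ) : ℝ :=
  sphSurface n * ∫ φ in (0 : ℝ)..π, Real.sin φ ^ (((n : ℝ) + (m : ℝ)) / 2)

/-- The sharp Frank–Seiringer constant `c_p = min_{0<t≤1/2} [(1−t)^p − t^p + p t^{p−1}]`. -/
def cFS (p : ℝ) : ℝ :=
  sInf {y : ℝ | ∃ t : ℝ, 0 < t ∧ t ≤ 1 / 2 ∧ y = (1 - t) ^ p - t ^ p + p * t ^ (p - 1)}

/-- Compactly supported smooth test functions with (closed) support inside `s`. -/
def IsTest {n : ℕ} (s : Set (GPt n)) (u : GPt n → ℝ) : Prop :=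
  ContDiff ℝ (⊤ : ℕ∞) u ∧ HasCompactSupport u ∧ tsupport u ⊆ s

/-- A function on the Grushin space is radial if it depends only on the homogeneous norm. -/
def IsRadial {n : ℕ} (u : GPt n → ℝ) : Prop :=
  ∃ f : ℝ → ℝ, ∀ z, u z = f (gNorm z)

/-- The distance function `d_H(u,R)`. -/
def dH {n : ℕ} (Q p β R : ℝ) (u : GPt n → ℝ) : ℝ :=
  (∫ z : GPt n,
      |u z - R ^ ((Q - p - β) / p) * uScaled R u z * gNorm z ^ (-((Q - p - β) / p))| ^ p *
        gPsi z ^ (p / 2) / (|Real.log (R / gNorm z)| ^ p * gNorm z ^ (p + β))) ^ (1 / p)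

/-- The distance function `d_R(u,k,β)`. -/
def dRdist {n : ℕ} (Q p β R : ℝ) (k : ℕ) (u : GPt n → ℝ) : ℝ :=
  (∫ z : GPt n,
      (|u z| ^ ((p - 2) / 2) * u z -
          |uScaled R u z| ^ ((p - 2) / 2) * uScaled R u z *
            (gNorm z / R) ^ (-((Q - (k : ℝ) * p - β) / 2))) ^ 2 *
        gPsi z ^ (p / 2) /
        (gNorm z ^ ((k : ℝ) * p + β) * Real.log (R / gNorm z) ^ 2)) ^ ((1 : ℝ) / 2)

/-- The distance function `d_C(u,R)`. -/
def dCdist {n : ℕ} (Q p R : ℝ) (u : GPt n → ℝ) : ℝ :=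
  (∫ z in {z : GPt n | gNorm z < 1},
      |u z - Real.log (1 / gNorm z) ^ ((p - 1) / p) * R ^ ((p - 1) / p) *
          uScaled (Real.exp (-1 / R)) u z| ^ p *
        gPsi z ^ (p / 2) /
        (gNorm z ^ Q * Real.log (1 / gNorm z) ^ p *
          |Real.log (R * Real.log (1 / gNorm z))| ^ p)) ^ (1 / p)

/-- The anisotropic dilation `(x, t) ↦ (s x, s² t)`. -/
def gDil {n : ℕ} (s : ℝ) (y : GPt n) : GPt n := (s • y.1, s ^ 2 * y.2)

section Dilation

variable {n : ℕ}

lemma gNorm_nonneg (z : GPt n) : 0 ≤ gNorm z := by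
  unfold gNorm; positivity

lemma gNorm_pow_four (z : GPt n) : gNorm z ^ 4 = ‖z.1‖ ^ 4 + 4 * z.2 ^ 2 := by
  unfold gNorm
  rw [← Real.rpow_natCast, ← Real.rpow_mul (by positivity)]
  norm_num

lemma continuous_gNorm : Continuous (gNorm : GPt n → ℝ) := by
  unfold gNorm
  exact (by fun_prop : Continuous fun z : GPt n => ‖z.1‖ ^ 4 + 4 * z.2 ^ 2).rpow_const
    (fun _ => Or.inr (by norm_num))

lemma measurable_gNorm : Measurable (gNorm : GPt n → ℝ) := continuous_gNorm.measurable

lemma measurable_gPsi : Measurable (gPsi : GPt n → ℝ) := by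
  unfold gPsi
  have := measurable_gNorm (n := n)
  fun_prop

lemma gPsi_nonneg (z : GPt n) : 0 ≤ gPsi z := by
  unfold gPsi; positivity

lemma norm_fst_le_gNorm (z : GPt n) : ‖z.1‖ ≤ gNorm z := by
  refine le_of_pow_le_pow_left₀ (n := 4) (by norm_num) (gNorm_nonneg z) ?_
  rw [gNorm_pow_four]; nlinarith [sq_nonneg z.2]

lemma abs_snd_le_gNorm_sq (z : GPt n) : |z.2| ≤ gNorm z ^ 2 := by
  refine abs_le_of_sq_le_sq ?_ (sq_nonneg _)
  rw [← pow_mul, gNorm_pow_four]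
  nlinarith [sq_nonneg z.2, pow_nonneg (norm_nonneg z.1) 4]

lemma gNorm_eq_zero_iff (z : GPt n) : gNorm z = 0 ↔ z = 0 := by
  constructor
  · intro h
    have h1 := norm_fst_le_gNorm z
    have h2 := abs_snd_le_gNorm_sq z
    rw [h] at h1 h2
    have h3 : z.1 = 0 := norm_le_zero_iff.1 h1
    have h4 : z.2 = 0 := by simpa using h2
    exact Prod.ext h3 h4
  · rintro rfl
    simp [gNorm]

lemma gNorm_pos_iff (z : GPt n) : 0 < gNorm z ↔ z ≠ 0 := by
  rw [(gNorm_nonneg z).lt_iff_ne, ne_comm, Ne, gNorm_eq_zero_iff]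

lemma gPsi_le_one (z : GPt n) : gPsi z ≤ 1 := by
  unfold gPsi
  exact div_le_one_of_le₀ (pow_le_pow_left₀ (norm_nonneg _) (norm_fst_le_gNorm z) 2) (sq_nonneg _)

lemma gNorm_gDil {s : ℝ} (hs : 0 ≤ s) (y : GPt n) : gNorm (gDil s y) = s * gNorm y := by
  refine (pow_left_inj₀ (gNorm_nonneg _) (mul_nonneg hs (gNorm_nonneg y)) (n := 4) (by norm_num)).1 ?_
  rw [mul_pow, gNorm_pow_four, gNorm_pow_four]
  simp only [gDil, norm_smul, Real.norm_eq_abs, abs_of_nonneg hs]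
  ring

lemma gPsi_gDil {s : ℝ} (hs : 0 < s) (y : GPt n) : gPsi (gDil s y) = gPsi y := by
  unfold gPsi
  rw [gNorm_gDil hs.le]
  simp only [gDil, norm_smul, Real.norm_eq_abs, abs_of_pos hs, mul_pow]
  rw [mul_div_mul_left _ _ (by positivity)]

lemma gDil_gDil (r s : ℝ) (y : GPt n) : gDil r (gDil s y) = gDil (r * s) y := by
  simp only [gDil, smul_smul, Prod.mk.injEq, true_and]
  ring

lemma gDil_one (y : GPt n) : gDil 1 y = y := by simp [gDil]

lemma continuous_gDil_uncurry : Continuous fun q : GPt n × ℝ => gDil q.2 q.1 := by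
  unfold gDil; fun_prop

lemma measurable_gDil (s : ℝ) : Measurable (gDil s : GPt n → GPt n) := by
  unfold gDil; fun_prop

lemma map_gDil_volume {s : ℝ} (hs : 0 < s) :
    Measure.map (gDil s) (volume : Measure (GPt n)) =
      ENNReal.ofReal ((s ^ (n + 2))⁻¹) • volume := by
  have h1 : (gDil s : GPt n → GPt n) =
      Prod.map (fun x : EuclideanSpace ℝ (Fin n) => s • x) (fun t : ℝ => s ^ 2 • t) := by
    ext z <;> simp [gDil]
  rw [h1, Measure.volume_eq_prod, ← Measure.map_prod_map _ _ (by fun_prop) (by fun_prop),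
    Measure.map_addHaar_smul _ hs.ne', Measure.map_addHaar_smul _ (by positivity),
    Measure.prod_smul_left, Measure.prod_smul_right, smul_smul,
    ← ENNReal.ofReal_mul (by positivity), ← abs_mul, abs_of_nonneg (by positivity)]
  congr 2
  simp only [finrank_euclideanSpace, Fintype.card_fin, Module.finrank_self, pow_one]
  rw [← mul_inv, ← pow_add]

lemma lintegral_comp_gDil {s : ℝ} (hs : 0 < s) {F : GPt n → ENNReal} (hF : Measurable F) :
    ∫⁻ y, F (gDil s y) = ENNReal.ofReal ((s ^ (n + 2))⁻¹) * ∫⁻ z, F z := by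
  rw [← lintegral_map hF (measurable_gDil s), map_gDil_volume hs, lintegral_smul_measure,
    smul_eq_mul]

/-- The gauge annulus `1 ≤ ϱ ≤ 2`. -/
def gAnnulus (n : ℕ) : Set (GPt n) := {y | 1 ≤ gNorm y ∧ gNorm y ≤ 2}

lemma measurableSet_gAnnulus : MeasurableSet (gAnnulus n) :=
  (measurableSet_le measurable_const measurable_gNorm).inter
    (measurableSet_le measurable_gNorm measurable_const)

lemma isCompact_gNorm_le (r : ℝ) : IsCompact {z : GPt n | gNorm z ≤ r} := by
  refine Metric.isCompact_of_isClosed_isBounded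
    (isClosed_le continuous_gNorm continuous_const) ?_
  refine isBounded_iff_forall_norm_le.2 ⟨max r (r ^ 2), fun z hz => ?_⟩
  have hz : gNorm z ≤ r := hz
  rw [Prod.norm_def]
  exact max_le_max ((norm_fst_le_gNorm z).trans hz)
    ((abs_snd_le_gNorm_sq z).trans (pow_le_pow_left₀ (gNorm_nonneg z) hz 2))

lemma volume_gAnnulus_lt_top : volume (gAnnulus n) < ⊤ :=
  (measure_mono fun _ hz => hz.2).trans_lt (isCompact_gNorm_le (n := n) 2).measure_lt_top

lemma lintegral_inv_gAnnulus {z : GPt n} (hz : z ≠ 0) :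
    ∫⁻ s in Set.Ioi (0 : ℝ), ENNReal.ofReal s⁻¹ * (gAnnulus n).indicator 1 (gDil s⁻¹ z) =
      ENNReal.ofReal (Real.log 2) := by
  have hρ := (gNorm_pos_iff z).2 hz
  have h1 : ∀ s ∈ Set.Ioi (0 : ℝ),
      ENNReal.ofReal s⁻¹ * (gAnnulus n).indicator 1 (gDil s⁻¹ z) =
        (Set.Icc (gNorm z / 2) (gNorm z)).indicator (fun s => ENNReal.ofReal s⁻¹) s := by
    intro s hs
    have hs : 0 < s := hs
    have h2 : gDil s⁻¹ z ∈ gAnnulus n ↔ s ∈ Set.Icc (gNorm z / 2) (gNorm z) := by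
      simp only [gAnnulus, Set.mem_ofPred_eq, gNorm_gDil (inv_pos.2 hs).le, Set.mem_Icc]
      rw [inv_mul_eq_div, le_div_iff₀ hs, div_le_iff₀ hs, and_comm, one_mul,
        div_le_iff₀ two_pos, mul_comm]
    by_cases h : s ∈ Set.Icc (gNorm z / 2) (gNorm z)
    · rw [Set.indicator_of_mem h, Set.indicator_of_mem (h2.2 h)]; simp
    · rw [Set.indicator_of_notMem h, Set.indicator_of_notMem (h2.not.2 h)]; simp
  have hsub : Set.Icc (gNorm z / 2) (gNorm z) ∩ Set.Ioi 0 = Set.Icc (gNorm z / 2) (gNorm z) :=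
    Set.inter_eq_left.2 fun s hs => lt_of_lt_of_le (by positivity) hs.1
  rw [setLIntegral_congr_fun measurableSet_Ioi h1, setLIntegral_indicator measurableSet_Icc, hsub,
    setLIntegral_congr Ioc_ae_eq_Icc.symm, ← ofReal_integral_eq_lintegral_ofReal,
    ← intervalIntegral.integral_of_le (by linarith), integral_inv_of_pos (by positivity) hρ]
  · congr 2; field_simp
  · refine (intervalIntegrable_iff_integrableOn_Ioc_of_le (by linarith)).1 ?_
    refine intervalIntegral.intervalIntegrable_inv (fun x hx => ?_) continuousOn_id
    rw [Set.uIcc_of_le (by linarith)] at hx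
    exact (lt_of_lt_of_le (by positivity) hx.1).ne'
  · refine (ae_restrict_mem measurableSet_Ioc).mono fun s hs => ?_
    exact inv_nonneg.2 ((by positivity : 0 ≤ gNorm z / 2).trans hs.1.le)

/-- Integration in polar coordinates adapted to the dilations, with the unit sphere smeared out
over an annulus. -/
lemma lintegral_eq_lintegral_rays {F : GPt n → ENNReal} (hF : Measurable F) :
    ENNReal.ofReal (Real.log 2) * ∫⁻ z, F z =
      ∫⁻ y in gAnnulus n, ∫⁻ s in Set.Ioi (0 : ℝ), ENNReal.ofReal (s ^ (n + 1)) * F (gDil s y) := by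
  have hind : Measurable ((gAnnulus n).indicator (1 : GPt n → ENNReal)) :=
    measurable_one.indicator measurableSet_gAnnulus
  have hD : Measurable fun q : GPt n × ℝ => gDil q.2 q.1 := continuous_gDil_uncurry.measurable
  have hDi : Measurable fun q : GPt n × ℝ => gDil q.2⁻¹ q.1 := by
    unfold gDil; fun_prop
  have hmeas : Measurable fun q : GPt n × ℝ =>
      (gAnnulus n).indicator (1 : GPt n → ENNReal) q.1 *
        (ENNReal.ofReal (q.2 ^ (n + 1)) * F (gDil q.2 q.1)) :=
    (hind.comp measurable_fst).mul ((by fun_prop : Measurable fun q : GPt n × ℝ =>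
      ENNReal.ofReal (q.2 ^ (n + 1))).mul (hF.comp hD))
  have hmeas' : Measurable fun q : GPt n × ℝ =>
      F q.1 * (ENNReal.ofReal q.2⁻¹ * (gAnnulus n).indicator 1 (gDil q.2⁻¹ q.1)) :=
    (hF.comp measurable_fst).mul ((by fun_prop : Measurable fun q : GPt n × ℝ =>
      ENNReal.ofReal q.2⁻¹).mul (hind.comp hDi))
  calc ENNReal.ofReal (Real.log 2) * ∫⁻ z, F z
      = ∫⁻ z, ∫⁻ s in Set.Ioi (0 : ℝ),
          F z * (ENNReal.ofReal s⁻¹ * (gAnnulus n).indicator 1 (gDil s⁻¹ z)) := by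
        rw [← lintegral_const_mul _ hF]
        refine lintegral_congr_ae ?_
        have h0 : ∀ᵐ z : GPt n, z ≠ 0 := by
          have : NullSingletonClass (volume : Measure (GPt n)) :=
            inferInstanceAs (NullSingletonClass (Measure.prod _ _))
          exact Measure.ae_ne volume 0
        filter_upwards [h0] with z hz
        rw [lintegral_const_mul, lintegral_inv_gAnnulus hz, mul_comm]
        exact (by fun_prop : Measurable fun s : ℝ => ENNReal.ofReal s⁻¹).mul
          (hind.comp (hDi.comp (measurable_const.prodMk measurable_id)))
    _ = ∫⁻ s in Set.Ioi (0 : ℝ), ∫⁻ z,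
          F z * (ENNReal.ofReal s⁻¹ * (gAnnulus n).indicator 1 (gDil s⁻¹ z)) :=
        lintegral_lintegral_swap hmeas'.aemeasurable
    _ = ∫⁻ s in Set.Ioi (0 : ℝ), ∫⁻ y, (gAnnulus n).indicator 1 y *
          (ENNReal.ofReal (s ^ (n + 1)) * F (gDil s y)) := by
        refine setLIntegral_congr_fun measurableSet_Ioi fun s hs => ?_
        have hs : 0 < s := hs
        have hG : Measurable fun z : GPt n => (gAnnulus n).indicator 1 (gDil s⁻¹ z) *
            (ENNReal.ofReal (s ^ (n + 1)) * F z) :=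
          (hind.comp (measurable_gDil _)).mul (measurable_const.mul hF)
        have h1 := lintegral_comp_gDil hs hG
        simp only [gDil_gDil, inv_mul_cancel₀ hs.ne', gDil_one] at h1
        rw [h1, ← lintegral_const_mul _ hG]
        refine lintegral_congr fun z => ?_
        have h2 : ENNReal.ofReal s⁻¹ =
            ENNReal.ofReal ((s ^ (n + 2))⁻¹) * ENNReal.ofReal (s ^ (n + 1)) := by
          rw [← ENNReal.ofReal_mul (by positivity)]
          congr 1
          field_simp
          ring
        rw [h2]; ring
    _ = ∫⁻ y, ∫⁻ s in Set.Ioi (0 : ℝ), (gAnnulus n).indicator 1 y *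
          (ENNReal.ofReal (s ^ (n + 1)) * F (gDil s y)) :=
        (lintegral_lintegral_swap hmeas.aemeasurable).symm
    _ = _ := by
        rw [← lintegral_indicator measurableSet_gAnnulus]
        refine lintegral_congr fun y => ?_
        by_cases hy : y ∈ gAnnulus n
        · simp [hy]
        · simp [hy]

lemma lintegral_mono_of_rays {F G : GPt n → ENNReal} (hF : Measurable F) (hG : Measurable G)
    (h : ∀ y : GPt n, y ≠ 0 →
      ∫⁻ s in Set.Ioi (0 : ℝ), ENNReal.ofReal (s ^ (n + 1)) * F (gDil s y) ≤
        ∫⁻ s in Set.Ioi (0 : ℝ), ENNReal.ofReal (s ^ (n + 1)) * G (gDil s y)) :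
    ∫⁻ z, F z ≤ ∫⁻ z, G z := by
  have h2 : ENNReal.ofReal (Real.log 2) ≠ 0 := by
    simpa using Real.log_pos one_lt_two
  rw [← ENNReal.mul_le_mul_iff_right h2 ENNReal.ofReal_ne_top, lintegral_eq_lintegral_rays hF,
    lintegral_eq_lintegral_rays hG]
  refine setLIntegral_mono' measurableSet_gAnnulus fun y hy => h y ?_
  exact (gNorm_pos_iff y).1 (one_pos.trans_le hy.1)

lemma lintegral_lt_top_of_rays {F : GPt n → ENNReal} (hF : Measurable F) (C : ℝ)
    (h : ∀ y ∈ gAnnulus n,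
      ∫⁻ s in Set.Ioi (0 : ℝ), ENNReal.ofReal (s ^ (n + 1)) * F (gDil s y) ≤ ENNReal.ofReal C) :
    ∫⁻ z, F z < ⊤ := by
  have h2 : ENNReal.ofReal (Real.log 2) ≠ 0 := by
    simpa using Real.log_pos one_lt_two
  have h3 : ENNReal.ofReal (Real.log 2) * ∫⁻ z, F z < ⊤ := by
    rw [lintegral_eq_lintegral_rays hF]
    refine (setLIntegral_mono' measurableSet_gAnnulus h).trans_lt ?_
    rw [setLIntegral_const]
    exact ENNReal.mul_lt_top ENNReal.ofReal_lt_top volume_gAnnulus_lt_top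
  exact (ENNReal.lt_top_of_mul_ne_top_right h3.ne h2)

end Dilation

section Ray

variable {p b c d R : ℝ}

lemma mul_rpow_sub_one_mul_le {γ y g : ℝ} (hp : 1 < p) (hγ : 0 < γ) (hy : 0 ≤ y) (hg : 0 ≤ g) :
    p * y ^ (p - 1) * g ≤ (p - 1) * γ * y ^ p + γ ^ (1 - p) * g ^ p := by
  have hp0 : 0 < p := by linarith
  have h := Real.geom_mean_le_arith_mean2_weighted (w₁ := (p - 1) / p) (w₂ := 1 / p)
    (p₁ := y ^ p) (p₂ := (g / γ) ^ p) (div_nonneg (by linarith) hp0.le) (by positivity)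
    (by positivity) (by positivity) (by field_simp; ring)
  rw [← Real.rpow_mul hy, ← Real.rpow_mul (by positivity), mul_div_cancel₀ _ hp0.ne',
    mul_one_div_cancel hp0.ne', Real.rpow_one] at h
  have h3 : γ ^ (1 - p) * g ^ p = γ * (g / γ) ^ p := by
    rw [Real.div_rpow hg hγ.le, Real.rpow_sub hγ, Real.rpow_one]; ring
  rw [h3]
  have h4 := mul_le_mul_of_nonneg_left h (mul_pos hp0 hγ).le
  calc p * y ^ (p - 1) * g = p * γ * (y ^ (p - 1) * (g / γ)) := by field_simp
    _ ≤ _ := h4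
    _ = _ := by field_simp

/-- The boundary weight `1 - (s/R)^c` along a ray. -/
def rayDefect (c R s : ℝ) : ℝ := 1 - (s / R) ^ c

lemma rayDefect_pos (hc : 0 < c) {s : ℝ} (hs : 0 ≤ s) (hsR : s < R) : 0 < rayDefect c R s := by
  have hR : 0 < R := hs.trans_lt hsR
  exact sub_pos.2 (Real.rpow_lt_one (by positivity) ((div_lt_one hR).2 hsR) hc)

lemma continuous_rayDefect (hc : 0 < c) : Continuous (rayDefect c R) := by
  unfold rayDefect
  exact continuous_const.sub ((continuous_id.div_const R).rpow_const fun _ => Or.inr hc.le)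

lemma hasDerivAt_rayDefect (hR : 0 < R) {s : ℝ} (hs : 0 < s) :
    HasDerivAt (rayDefect c R) (-(c * (s / R) ^ c / s)) s := by
  have h1 : HasDerivAt (fun s : ℝ => s / R) (1 / R) s := (hasDerivAt_id s).div_const R
  have h2 := (h1.rpow_const (p := c) (Or.inl (by positivity))).const_sub 1
  refine h2.congr_deriv ?_
  rw [Real.rpow_sub_one (by positivity)]
  field_simp

/-- The weight `s^(d-1) (1 - (s/R)^c)^(-b)` of the one-dimensional Hardy inequality. -/
def rayWeight (b c d R s : ℝ) : ℝ := s ^ (d - 1) * rayDefect c R s ^ (-b)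

lemma rayWeight_nonneg (hc : 0 < c) {s : ℝ} (hs : 0 ≤ s) (hsR : s < R) :
    0 ≤ rayWeight b c d R s :=
  mul_nonneg (Real.rpow_nonneg hs _) (Real.rpow_nonneg (rayDefect_pos hc hs hsR).le _)

lemma integrableOn_rayWeight_mul (hc : 0 < c) (hd : 0 < d) {R₁ : ℝ} (hR₁ : 0 ≤ R₁) (hRR : R₁ < R)
    {h : ℝ → ℝ} (hh : ContinuousOn h (Set.Icc 0 R₁)) :
    IntegrableOn (fun s => rayWeight b c d R s * h s) (Set.Icc 0 R₁) := by
  have h1 : IntervalIntegrable (fun s : ℝ => s ^ (d - 1)) volume 0 R₁ :=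
    intervalIntegral.intervalIntegrable_rpow' (by linarith)
  have h2 : ContinuousOn (fun s => rayDefect c R s ^ (-b) * h s) (Set.uIcc 0 R₁) := by
    rw [Set.uIcc_of_le hR₁]
    refine ContinuousOn.mul ((continuous_rayDefect hc).continuousOn.rpow_const fun s hs => ?_) hh
    exact Or.inl (rayDefect_pos hc hs.1 (hs.2.trans_lt hRR)).ne'
  have h3 := h1.continuousOn_mul h2
  rw [intervalIntegrable_iff_integrableOn_Icc_of_le hR₁] at h3
  refine h3.congr_fun (fun s _ => ?_) measurableSet_Icc
  simp only [rayWeight]; ring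

lemma intervalIntegral_hardy_ray (hp : 1 < p) (hb : 1 < b) (hc : 0 < c) (hd : (b - 1) * c ≤ d)
    {R₁ : ℝ} (hR₁ : 0 < R₁) (hRR : R₁ < R) {f : ℝ → ℝ} (hf : ContDiff ℝ 1 f) (h0 : f R₁ = 0) :
    ∫ s in (0 : ℝ)..R₁, ((b - 1) * c / p) ^ p * (rayWeight b c d R s * |f s| ^ p) ≤
      ∫ s in (0 : ℝ)..R₁,
        rayWeight b c d R s * (s * rayDefect c R s * |deriv f s|) ^ p := by
  have hp0 : 0 < p := by linarith
  have hR : 0 < R := hR₁.trans hRR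
  have hbc : 0 < (b - 1) * c := mul_pos (by linarith) hc
  have hd0 : 0 < d := hbc.trans_le hd
  set γ := (b - 1) * c / p with hγdef
  have hγ : 0 < γ := div_pos hbc hp0
  have hfc : Continuous f := hf.continuous
  have hf'c : Continuous (deriv f) := hf.continuous_deriv le_rfl
  have hvc := continuous_rayDefect (c := c) (R := R) hc
  have hv : ∀ s ∈ Set.Icc 0 R₁, 0 < rayDefect c R s := fun s hs =>
    rayDefect_pos hc hs.1 (hs.2.trans_lt hRR)
  have hA : IntegrableOn (fun s => rayWeight b c d R s * |f s| ^ p) (Set.Icc 0 R₁) :=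
    integrableOn_rayWeight_mul hc hd0 hR₁.le hRR
      (hfc.abs.rpow_const fun _ => Or.inr hp0.le).continuousOn
  have hB : IntegrableOn (fun s => rayWeight b c d R s *
      (s * rayDefect c R s * |deriv f s|) ^ p) (Set.Icc 0 R₁) :=
    integrableOn_rayWeight_mul hc hd0 hR₁.le hRR
      (((continuous_id.mul hvc).mul hf'c.abs).rpow_const fun _ => Or.inr hp0.le).continuousOn
  have hA' := (intervalIntegrable_iff_integrableOn_Icc_of_le hR₁.le).2 hA
  have hB' := (intervalIntegrable_iff_integrableOn_Icc_of_le hR₁.le).2 hB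
  have key := intervalIntegral.integral_le_sub_of_hasDeriv_right_of_le (a := 0) (b := R₁)
    (g := fun s => s ^ d * rayDefect c R s ^ (1 - b) * |f s| ^ p)
    (g' := fun s => (d * s ^ (d - 1) * rayDefect c R s ^ (1 - b) +
        s ^ d * (-(c * (s / R) ^ c / s) * (1 - b) * rayDefect c R s ^ (1 - b - 1))) * |f s| ^ p +
        s ^ d * rayDefect c R s ^ (1 - b) * (p * |f s| ^ (p - 2) * f s * deriv f s))
    (φ := fun s => γ * (rayWeight b c d R s * |f s| ^ p) -
      γ ^ (1 - p) * (rayWeight b c d R s * (s * rayDefect c R s * |deriv f s|) ^ p))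
    hR₁.le ?_ ?_ ((hA.const_mul γ).sub (hB.const_mul _)) ?_
  · rw [intervalIntegral.integral_sub (hA'.const_mul _) (hB'.const_mul _),
      intervalIntegral.integral_const_mul, intervalIntegral.integral_const_mul] at key
    simp only [h0, abs_zero, Real.zero_rpow hp0.ne', mul_zero, Real.zero_rpow hd0.ne', zero_mul,
      sub_zero, sub_nonpos] at key
    rw [intervalIntegral.integral_const_mul]
    have h1 := mul_le_mul_of_nonneg_left key (Real.rpow_nonneg hγ.le (p - 1))
    rw [← mul_assoc, ← mul_assoc, ← Real.rpow_add hγ, ← Real.rpow_add_one hγ.ne'] at h1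
    simpa using h1
  · refine ((continuous_id.rpow_const fun _ => Or.inr hd0.le).continuousOn.mul
      (hvc.continuousOn.rpow_const fun s hs => Or.inl (hv s hs).ne')).mul
      (hfc.abs.rpow_const fun _ => Or.inr hp0.le).continuousOn
  · intro s hs
    have h1 : HasDerivAt (fun s : ℝ => s ^ d) (d * s ^ (d - 1)) s :=
      Real.hasDerivAt_rpow_const (Or.inl hs.1.ne')
    have h2 := (hasDerivAt_rayDefect (c := c) hR hs.1).rpow_const (p := 1 - b)
      (Or.inl (hv s ⟨hs.1.le, hs.2.le⟩).ne')
    have h3 := (hasDerivAt_abs_rpow (f s) hp).comp s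
      ((hf.differentiable one_ne_zero) s).hasDerivAt
    exact ((h1.mul h2).mul h3).hasDerivWithinAt
  · intro s hs
    have hs0 : 0 < s := hs.1
    have hv0 := hv s ⟨hs.1.le, hs.2.le⟩
    have hW : 0 ≤ rayWeight b c d R s := rayWeight_nonneg hc hs0.le (hs.2.trans hRR)
    have hτ : (s / R) ^ c = 1 - rayDefect c R s := by simp [rayDefect]
    have e1 : s ^ d = s ^ (d - 1) * s := by
      rw [Real.rpow_sub_one hs0.ne']; field_simp
    have e2 : rayDefect c R s ^ (1 - b) = rayDefect c R s ^ (-b) * rayDefect c R s := by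
      rw [← Real.rpow_add_one hv0.ne']; ring_nf
    have e3 : 1 - b - 1 = -b := by ring
    have hyoung := mul_rpow_sub_one_mul_le (y := |f s|)
      (g := s * rayDefect c R s * |deriv f s|) hp hγ (abs_nonneg _) (by positivity)
    have hcross : -(|f s| ^ (p - 1) * |deriv f s|) ≤ |f s| ^ (p - 2) * f s * deriv f s := by
      rcases eq_or_ne (f s) 0 with h | h
      · simp [h, Real.zero_rpow (by linarith : p - 1 ≠ 0)]
      · have hpos : 0 < |f s| := abs_pos.2 h
        have : |f s| ^ (p - 1) = |f s| ^ (p - 2) * |f s| := by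
          rw [← Real.rpow_add_one hpos.ne']; ring_nf
        rw [this, mul_assoc, mul_assoc, ← mul_neg, ← abs_mul]
        exact mul_le_mul_of_nonneg_left (neg_abs_le _) (by positivity)
    have hmain : γ * |f s| ^ p - γ ^ (1 - p) * (s * rayDefect c R s * |deriv f s|) ^ p ≤
        (d * rayDefect c R s + (b - 1) * c * (s / R) ^ c) * |f s| ^ p +
          s * rayDefect c R s * (p * (|f s| ^ (p - 2) * f s * deriv f s)) := by
      have i1 : (b - 1) * c ≤ d * rayDefect c R s + (b - 1) * c * (s / R) ^ c := by
        rw [hτ]; nlinarith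
      have i2 := mul_le_mul_of_nonneg_right i1 (by positivity : 0 ≤ |f s| ^ p)
      have i3 := mul_le_mul_of_nonneg_left hcross
        (by positivity : 0 ≤ s * rayDefect c R s * p)
      have i4 : (b - 1) * c = p * γ := by rw [hγdef]; field_simp
      rw [i4] at i2 ⊢
      linarith
    have := mul_le_mul_of_nonneg_left hmain hW
    calc _ = rayWeight b c d R s * (γ * |f s| ^ p -
          γ ^ (1 - p) * (s * rayDefect c R s * |deriv f s|) ^ p) := by ring
      _ ≤ _ := this
      _ = _ := by
        simp only [rayWeight]
        rw [e3, e1, e2]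
        field_simp
        ring

lemma lintegral_hardy_ray (hp : 1 < p) (hb : 1 < b) (hc : 0 < c) (hd : (b - 1) * c ≤ d)
    {R₁ : ℝ} (hR₁ : 0 < R₁) (hRR : R₁ < R) {f : ℝ → ℝ} (hf : ContDiff ℝ 1 f)
    (h0 : ∀ s, R₁ ≤ s → f s = 0) :
    ∫⁻ s in Set.Ioi (0 : ℝ),
        ENNReal.ofReal (((b - 1) * c / p) ^ p * (rayWeight b c d R s * |f s| ^ p)) ≤
      ∫⁻ s in Set.Ioi (0 : ℝ), ENNReal.ofReal
        (rayWeight b c d R s * (s * rayDefect c R s * |deriv f s|) ^ p) := by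
  have hp0 : 0 < p := by linarith
  have hd0 : 0 < d := (mul_pos (by linarith) hc).trans_le hd
  have hvc := continuous_rayDefect (c := c) (R := R) hc
  have hγ : 0 ≤ ((b - 1) * c / p) ^ p :=
    Real.rpow_nonneg (div_nonneg (mul_pos (by linarith) hc).le hp0.le) _
  have hA : IntegrableOn (fun s => ((b - 1) * c / p) ^ p * (rayWeight b c d R s * |f s| ^ p))
      (Set.Ioc 0 R₁) :=
    ((integrableOn_rayWeight_mul hc hd0 hR₁.le hRR
      (hf.continuous.abs.rpow_const fun _ => Or.inr hp0.le).continuousOn).mono_set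
      Set.Ioc_subset_Icc_self).const_mul _
  have hB : IntegrableOn (fun s => rayWeight b c d R s *
      (s * rayDefect c R s * |deriv f s|) ^ p) (Set.Ioc 0 R₁) :=
    (integrableOn_rayWeight_mul hc hd0 hR₁.le hRR
      (((continuous_id.mul hvc).mul (hf.continuous_deriv le_rfl).abs).rpow_const
        fun _ => Or.inr hp0.le).continuousOn).mono_set Set.Ioc_subset_Icc_self
  have hW : ∀ᵐ s ∂volume.restrict (Set.Ioc 0 R₁), 0 ≤ rayWeight b c d R s ∧
      0 ≤ s * rayDefect c R s := by
    filter_upwards [ae_restrict_mem measurableSet_Ioc] with s hs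
    exact ⟨rayWeight_nonneg hc hs.1.le (hs.2.trans_lt hRR),
      mul_nonneg hs.1.le (rayDefect_pos hc hs.1.le (hs.2.trans_lt hRR)).le⟩
  calc _ = ∫⁻ s in Set.Ioc 0 R₁,
        ENNReal.ofReal (((b - 1) * c / p) ^ p * (rayWeight b c d R s * |f s| ^ p)) := by
        rw [← Set.Ioc_union_Ioi_eq_Ioi hR₁.le, lintegral_union measurableSet_Ioi
          (Set.Ioc_disjoint_Ioi le_rfl), setLIntegral_eq_zero measurableSet_Ioi, add_zero]
        intro s hs
        simp [h0 s (le_of_lt hs), Real.zero_rpow hp0.ne']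
    _ = ENNReal.ofReal (∫ s in (0 : ℝ)..R₁,
        ((b - 1) * c / p) ^ p * (rayWeight b c d R s * |f s| ^ p)) := by
        rw [intervalIntegral.integral_of_le hR₁.le, ofReal_integral_eq_lintegral_ofReal hA]
        filter_upwards [hW] with s hs
        exact mul_nonneg hγ (mul_nonneg hs.1 (by positivity))
    _ ≤ ENNReal.ofReal (∫ s in (0 : ℝ)..R₁,
        rayWeight b c d R s * (s * rayDefect c R s * |deriv f s|) ^ p) :=
        ENNReal.ofReal_le_ofReal
          (intervalIntegral_hardy_ray hp hb hc hd hR₁ hRR hf (h0 _ le_rfl))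
    _ = ∫⁻ s in Set.Ioc 0 R₁, ENNReal.ofReal
        (rayWeight b c d R s * (s * rayDefect c R s * |deriv f s|) ^ p) := by
        rw [intervalIntegral.integral_of_le hR₁.le, ofReal_integral_eq_lintegral_ofReal hB]
        filter_upwards [hW] with s hs
        exact mul_nonneg hs.1 (Real.rpow_nonneg (mul_nonneg hs.2 (abs_nonneg _)) _)
    _ ≤ _ := lintegral_mono_set fun s hs => hs.1

end Ray

section Test

variable {n : ℕ}

/-- The density of the weighted radial energy. -/
def hardyGrad (p a b c R : ℝ) (u : GPt n → ℝ) (z : GPt n) : ℝ :=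
  gPsi z ^ (p / 2) * |radialDeriv u z| ^ p /
    (gNorm z ^ (a - p) * (1 - (gNorm z / R) ^ c) ^ (b - p))

/-- The density of the weighted Hardy potential. -/
def hardyPot (p a b c R : ℝ) (u : GPt n → ℝ) (z : GPt n) : ℝ :=
  |u z| ^ p * gPsi z ^ (p / 2) / (gNorm z ^ a * (1 - (gNorm z / R) ^ c) ^ b)

variable {p a b c R : ℝ} {u : GPt n → ℝ}

lemma IsTest.exists_radius (hR : 0 < R) (hu : IsTest {z : GPt n | gNorm z < R} u) :
    ∃ R₀, 0 < R₀ ∧ R₀ < R ∧ ∀ z, R₀ ≤ gNorm z → z ∉ tsupport u := by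
  rcases (tsupport u).eq_empty_or_nonempty with h | h
  · exact ⟨R / 2, by linarith, by linarith, fun z _ => by simp [h]⟩
  · obtain ⟨w, hw, hmax⟩ := hu.2.1.isCompact.exists_isMaxOn h continuous_gNorm.continuousOn
    have hwR : gNorm w < R := hu.2.2 hw
    have hw0 := gNorm_nonneg w
    refine ⟨(gNorm w + R) / 2, by linarith, by linarith, fun z hz hzu => ?_⟩
    have : gNorm z ≤ gNorm w := hmax hzu
    linarith

lemma radialDeriv_gDil {s : ℝ} (hs : 0 < s) {y : GPt n} (hy : y ≠ 0) :
    radialDeriv u (gDil s y) = (gNorm y)⁻¹ * deriv (fun r => u (gDil r y)) s := by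
  have hρ := (gNorm_pos_iff y).2 hy
  unfold radialDeriv
  rw [gNorm_gDil hs.le]
  have h1 : (fun σ : ℝ => u ((σ / (s * gNorm y)) • (gDil s y).1,
      σ ^ 2 / (s * gNorm y) ^ 2 * (gDil s y).2)) =
      fun σ => (fun r => u (gDil r y)) ((gNorm y)⁻¹ * σ) := by
    ext σ
    simp only [gDil, smul_smul]
    congr 2
    · congr 1; field_simp
    · field_simp
  have h2 : (gNorm y)⁻¹ * (s * gNorm y) = s := by field_simp
  have h3 := deriv_comp_mul_left (gNorm y)⁻¹ (fun r => u (gDil r y)) (s * gNorm y)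
  rw [h2, smul_eq_mul] at h3
  rw [h1, h3]

lemma radialDeriv_eq_fderiv (hu : Differentiable ℝ u) (z : GPt n) :
    radialDeriv u z = fderiv ℝ u z ((gNorm z)⁻¹ • z.1, 2 * z.2 / gNorm z) := by
  rcases eq_or_ne z 0 with rfl | hz
  · have : gNorm (0 : GPt n) = 0 := (gNorm_eq_zero_iff _).2 rfl
    simp [radialDeriv, this]
    exact (map_zero (fderiv ℝ u 0)).symm
  · have hρ := (gNorm_pos_iff z).2 hz
    have h1 : HasDerivAt (fun s : ℝ => s / gNorm z) (gNorm z)⁻¹ (gNorm z) := by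
      simpa using (hasDerivAt_id (gNorm z)).div_const (gNorm z)
    have h2 : HasDerivAt (fun s : ℝ => s ^ 2 / gNorm z ^ 2 * z.2) (2 * z.2 / gNorm z)
        (gNorm z) := by
      refine (((hasDerivAt_pow 2 (gNorm z)).div_const (gNorm z ^ 2)).mul_const z.2).congr_deriv ?_
      norm_num
      field_simp
    have h3 := (h1.smul_const z.1).prodMk h2
    have h4 : HasFDerivAt u (fderiv ℝ u z)
        ((gNorm z / gNorm z) • z.1, gNorm z ^ 2 / gNorm z ^ 2 * z.2) := by
      rw [div_self hρ.ne', div_self (by positivity), one_smul, one_mul]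
      exact (hu z).hasFDerivAt
    exact (h4.comp_hasDerivAt (gNorm z) h3).deriv

lemma measurable_radialDeriv (hu : ContDiff ℝ (⊤ : ℕ∞) u) : Measurable (radialDeriv u) := by
  have h1 : radialDeriv u = (fun q : GPt n × GPt n => fderiv ℝ u q.1 q.2) ∘
      fun z => (z, ((gNorm z)⁻¹ • z.1, 2 * z.2 / gNorm z)) := by
    ext z; exact radialDeriv_eq_fderiv (hu.differentiable (by simp)) z
  rw [h1]
  have := measurable_gNorm (n := n)
  exact (hu.continuous_fderiv_apply (by simp)).measurable.comp (by fun_prop)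

lemma IsTest.measurable_hardyGrad {B : Set (GPt n)} (hu : IsTest B u) :
    Measurable (hardyGrad p a b c R u) := by
  unfold hardyGrad
  have := measurable_gNorm (n := n)
  have := measurable_gPsi (n := n)
  have := measurable_radialDeriv hu.1
  fun_prop

lemma IsTest.measurable_hardyPot {B : Set (GPt n)} (hu : IsTest B u) :
    Measurable (hardyPot p a b c R u) := by
  unfold hardyPot
  have := measurable_gNorm (n := n)
  have := measurable_gPsi (n := n)
  have := hu.1.continuous.measurable
  fun_prop

lemma radialDeriv_eq_zero (hu : Differentiable ℝ u) {z : GPt n} (hz : z ∉ tsupport u) :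
    radialDeriv u z = 0 := by
  rw [radialDeriv_eq_fderiv hu, fderiv_of_notMem_tsupport (𝕜 := ℝ) hz]
  rfl

lemma hardyPot_eq_zero (hp : 0 < p) {z : GPt n} (hz : z ∉ tsupport u) :
    hardyPot p a b c R u z = 0 := by
  simp [hardyPot, image_eq_zero_of_notMem_tsupport hz, Real.zero_rpow hp.ne']

lemma hardyGrad_eq_zero (hp : 0 < p) (hu : Differentiable ℝ u) {z : GPt n}
    (hz : z ∉ tsupport u) : hardyGrad p a b c R u z = 0 := by
  simp [hardyGrad, radialDeriv_eq_zero hu hz, Real.zero_rpow hp.ne']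

lemma gDefect_pos (hc : 0 < c) {z : GPt n} (hz : gNorm z < R) :
    0 < 1 - (gNorm z / R) ^ c :=
  rayDefect_pos hc (gNorm_nonneg z) hz

lemma IsTest.hardyPot_nonneg (hp : 0 < p) (hc : 0 < c)
    (hu : IsTest {z : GPt n | gNorm z < R} u) (z : GPt n) : 0 ≤ hardyPot p a b c R u z := by
  by_cases hz : z ∈ tsupport u
  · have := gDefect_pos hc (hu.2.2 hz)
    have := gNorm_nonneg z
    have := gPsi_nonneg z
    unfold hardyPot; positivity
  · rw [hardyPot_eq_zero hp hz]

lemma IsTest.hardyGrad_nonneg (hp : 0 < p) (hc : 0 < c)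
    (hu : IsTest {z : GPt n | gNorm z < R} u) (z : GPt n) : 0 ≤ hardyGrad p a b c R u z := by
  by_cases hz : z ∈ tsupport u
  · have := gDefect_pos hc (hu.2.2 hz)
    have := gNorm_nonneg z
    have := gPsi_nonneg z
    unfold hardyGrad; positivity
  · rw [hardyGrad_eq_zero hp (hu.1.differentiable (by simp)) hz]

lemma rayDefect_div_gNorm (s : ℝ) (y : GPt n) :
    rayDefect c (R / gNorm y) s = 1 - (s * gNorm y / R) ^ c := by
  unfold rayDefect; congr 2; rw [div_div_eq_mul_div]

/-- The constant factor that the densities pick up along the ray through `y`. -/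
def rayFactor (p a : ℝ) (y : GPt n) : ℝ := gPsi y ^ (p / 2) * gNorm y ^ (-a)

lemma rayFactor_nonneg (y : GPt n) : 0 ≤ rayFactor p a y :=
  mul_nonneg (Real.rpow_nonneg (gPsi_nonneg y) _) (Real.rpow_nonneg (gNorm_nonneg y) _)

lemma pow_mul_rpow_neg {s : ℝ} (hs : 0 < s) (a : ℝ) :
    s ^ (n + 1) * s ^ (-a) = s ^ ((n : ℝ) + 2 - a - 1) := by
  rw [← Real.rpow_natCast, ← Real.rpow_add hs]
  congr 1; push_cast; ring

lemma hardyPot_ray {s : ℝ} (hs : 0 < s) {y : GPt n} (hy : y ≠ 0)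
    (hv : 0 < rayDefect c (R / gNorm y) s) :
    s ^ (n + 1) * hardyPot p a b c R u (gDil s y) =
      rayFactor p a y *
        (rayWeight b c ((n : ℝ) + 2 - a) (R / gNorm y) s * |u (gDil s y)| ^ p) := by
  have hρ := (gNorm_pos_iff y).2 hy
  unfold hardyPot rayFactor rayWeight
  rw [gPsi_gDil hs, gNorm_gDil hs.le, ← rayDefect_div_gNorm, ← pow_mul_rpow_neg hs,
    Real.mul_rpow hs.le hρ.le, Real.rpow_neg hs.le, Real.rpow_neg hρ.le, Real.rpow_neg hv.le]
  field_simp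

lemma hardyGrad_ray {s : ℝ} (hs : 0 < s) {y : GPt n} (hy : y ≠ 0)
    (hv : 0 < rayDefect c (R / gNorm y) s) :
    s ^ (n + 1) * hardyGrad p a b c R u (gDil s y) =
      rayFactor p a y * (rayWeight b c ((n : ℝ) + 2 - a) (R / gNorm y) s *
        (s * rayDefect c (R / gNorm y) s * |deriv (fun r => u (gDil r y)) s|) ^ p) := by
  have hρ := (gNorm_pos_iff y).2 hy
  unfold hardyGrad rayFactor rayWeight
  rw [gPsi_gDil hs, gNorm_gDil hs.le, radialDeriv_gDil hs hy, ← rayDefect_div_gNorm,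
    ← pow_mul_rpow_neg hs, Real.mul_rpow hs.le hρ.le, abs_mul, abs_inv, abs_of_pos hρ,
    Real.mul_rpow (by positivity) (abs_nonneg _), Real.mul_rpow (by positivity) (abs_nonneg _),
    Real.mul_rpow hs.le hv.le, Real.inv_rpow hρ.le,
    Real.rpow_sub hs, Real.rpow_sub hρ, Real.rpow_sub hv,
    Real.rpow_neg hs.le, Real.rpow_neg hρ.le, Real.rpow_neg hv.le]
  field_simp

lemma contDiff_ray (hu : ContDiff ℝ (⊤ : ℕ∞) u) (y : GPt n) :
    ContDiff ℝ (⊤ : ℕ∞) fun r : ℝ => u (gDil r y) := by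
  refine hu.comp ?_
  unfold gDil; fun_prop

lemma IsTest.notMem_tsupport_of_rayDefect_nonpos (hc : 0 < c)
    (hu : IsTest {z : GPt n | gNorm z < R} u) {s : ℝ} (hs : 0 < s) {y : GPt n} (hy : y ≠ 0)
    (hv : rayDefect c (R / gNorm y) s ≤ 0) : gDil s y ∉ tsupport u := by
  have hρ := (gNorm_pos_iff y).2 hy
  intro h
  have h1 : gNorm (gDil s y) < R := hu.2.2 h
  rw [gNorm_gDil hs.le, ← lt_div_iff₀ hρ] at h1
  exact absurd (rayDefect_pos hc hs.le h1) hv.not_gt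

lemma IsTest.lintegral_hardyPot_ray (hp : 0 < p) (hc : 0 < c)
    (hu : IsTest {z : GPt n | gNorm z < R} u) {K : ℝ} {y : GPt n} (hy : y ≠ 0) :
    ∫⁻ s in Set.Ioi (0 : ℝ),
        ENNReal.ofReal (s ^ (n + 1)) * ENNReal.ofReal (K * hardyPot p a b c R u (gDil s y)) =
      ENNReal.ofReal (rayFactor p a y) * ∫⁻ s in Set.Ioi (0 : ℝ),
        ENNReal.ofReal (K * (rayWeight b c ((n : ℝ) + 2 - a) (R / gNorm y) s *
          |u (gDil s y)| ^ p)) := by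
  rw [← lintegral_const_mul' _ _ ENNReal.ofReal_ne_top]
  refine setLIntegral_congr_fun measurableSet_Ioi fun s hs => ?_
  have hs : 0 < s := hs
  rw [← ENNReal.ofReal_mul (by positivity), ← ENNReal.ofReal_mul (rayFactor_nonneg y)]
  congr 1
  rcases le_or_gt (rayDefect c (R / gNorm y) s) 0 with hv | hv
  · have h1 := hu.notMem_tsupport_of_rayDefect_nonpos hc hs hy hv
    simp [hardyPot_eq_zero hp h1, image_eq_zero_of_notMem_tsupport h1, Real.zero_rpow hp.ne']
  · rw [mul_left_comm, hardyPot_ray hs hy hv]; ring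

lemma IsTest.lintegral_hardyGrad_ray (hp : 0 < p) (hc : 0 < c)
    (hu : IsTest {z : GPt n | gNorm z < R} u) {y : GPt n} (hy : y ≠ 0) :
    ∫⁻ s in Set.Ioi (0 : ℝ),
        ENNReal.ofReal (s ^ (n + 1)) * ENNReal.ofReal (hardyGrad p a b c R u (gDil s y)) =
      ENNReal.ofReal (rayFactor p a y) * ∫⁻ s in Set.Ioi (0 : ℝ),
        ENNReal.ofReal (rayWeight b c ((n : ℝ) + 2 - a) (R / gNorm y) s *
          (s * rayDefect c (R / gNorm y) s * |deriv (fun r => u (gDil r y)) s|) ^ p) := by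
  have hρ := (gNorm_pos_iff y).2 hy
  rw [← lintegral_const_mul' _ _ ENNReal.ofReal_ne_top]
  refine setLIntegral_congr_fun measurableSet_Ioi fun s hs => ?_
  have hs : 0 < s := hs
  rw [← ENNReal.ofReal_mul (by positivity), ← ENNReal.ofReal_mul (rayFactor_nonneg y)]
  congr 1
  rcases le_or_gt (rayDefect c (R / gNorm y) s) 0 with hv | hv
  · have h1 := hu.notMem_tsupport_of_rayDefect_nonpos hc hs hy hv
    have hd := hu.1.differentiable (by simp)
    have h2 := radialDeriv_gDil (u := u) hs hy
    rw [radialDeriv_eq_zero hd h1] at h2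
    have h3 : deriv (fun r => u (gDil r y)) s = 0 := by
      rcases mul_eq_zero.1 h2.symm with h | h
      · exact absurd h (inv_pos.2 hρ).ne'
      · exact h
    simp [hardyGrad_eq_zero hp hd h1, h3, Real.zero_rpow hp.ne']
  · rw [hardyGrad_ray hs hy hv]

lemma IsTest.lintegral_hardyPot_le (hR : 0 < R) (hp : 1 < p) (hb : 1 < b) (hc : 0 < c)
    (ha : (b - 1) * c ≤ n + 2 - a) (hu : IsTest {z : GPt n | gNorm z < R} u) :
    ∫⁻ z, ENNReal.ofReal (((b - 1) * c / p) ^ p * hardyPot p a b c R u z) ≤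
      ∫⁻ z, ENNReal.ofReal (hardyGrad p a b c R u z) := by
  have hp0 : 0 < p := by linarith
  refine lintegral_mono_of_rays (hu.measurable_hardyPot.const_mul _).ennreal_ofReal
    hu.measurable_hardyGrad.ennreal_ofReal fun y hy => ?_
  have hρ := (gNorm_pos_iff y).2 hy
  rw [hu.lintegral_hardyPot_ray hp0 hc hy, hu.lintegral_hardyGrad_ray hp0 hc hy]
  refine mul_le_mul_right ?_ _
  obtain ⟨R₀, h0, h1, h2⟩ := hu.exists_radius hR
  refine lintegral_hardy_ray hp hb hc ha (div_pos h0 hρ) (div_lt_div_of_pos_right h1 hρ)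
    ((contDiff_ray hu.1 y).of_le (by exact_mod_cast le_top)) fun s hs => ?_
  have hs0 : 0 < s := (div_pos h0 hρ).trans_le hs
  refine image_eq_zero_of_notMem_tsupport (h2 _ ?_)
  rwa [gNorm_gDil hs0.le, ← div_le_iff₀ hρ]

lemma IsTest.exists_hardyGrad_le (hR : 0 < R) (hp : 0 < p) (hpb : p ≤ b) (hc : 0 < c)
    (hu : IsTest {z : GPt n | gNorm z < R} u) :
    ∃ C, 0 ≤ C ∧ ∀ z, z ≠ 0 → hardyGrad p a b c R u z ≤ C * gNorm z ^ (p - a) := by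
  obtain ⟨R₀, h0, h1, h2⟩ := hu.exists_radius hR
  have hd := hu.1.differentiable (by simp)
  obtain ⟨M, hM⟩ := (hu.2.1.fderiv (𝕜 := ℝ)).exists_bound_of_continuous
    (hu.1.continuous_fderiv (by simp))
  have hM0 : 0 ≤ M := (norm_nonneg _).trans (hM 0)
  have hv₀ : 0 < rayDefect c R R₀ := rayDefect_pos hc h0.le h1
  refine ⟨(M * max 1 (2 * R)) ^ p * (rayDefect c R R₀ ^ (b - p))⁻¹, by positivity,
    fun z hz => ?_⟩
  have hρ := (gNorm_pos_iff z).2 hz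
  by_cases hzR : R₀ ≤ gNorm z
  · rw [hardyGrad_eq_zero hp hd (h2 z hzR)]
    positivity
  · push Not at hzR
    have hr : |radialDeriv u z| ≤ M * max 1 (2 * R) := by
      rw [radialDeriv_eq_fderiv hd, ← Real.norm_eq_abs]
      refine (ContinuousLinearMap.le_opNorm _ _).trans
        (mul_le_mul (hM z) ?_ (norm_nonneg _) hM0)
      rw [Prod.norm_def]
      refine max_le_max ?_ ?_
      · rw [norm_smul, norm_inv, Real.norm_eq_abs, abs_of_pos hρ, inv_mul_le_one₀ hρ]
        exact norm_fst_le_gNorm z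
      · rw [Real.norm_eq_abs, abs_div, abs_of_pos hρ, div_le_iff₀ hρ, abs_mul, abs_two]
        have := abs_snd_le_gNorm_sq z
        nlinarith
    have hψ : gPsi z ^ (p / 2) ≤ 1 :=
      Real.rpow_le_one (gPsi_nonneg z) (gPsi_le_one z) (by positivity)
    have hv : rayDefect c R R₀ ≤ 1 - (gNorm z / R) ^ c := by
      unfold rayDefect
      gcongr
    unfold hardyGrad
    rw [mul_comm (gNorm z ^ (a - p)), ← div_div, div_eq_mul_inv _ (gNorm z ^ (a - p)),
      ← Real.rpow_neg hρ.le, neg_sub, div_eq_mul_inv]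
    have hv' : ((1 - (gNorm z / R) ^ c) ^ (b - p))⁻¹ ≤ (rayDefect c R R₀ ^ (b - p))⁻¹ := by
      gcongr
    have hg : gPsi z ^ (p / 2) * |radialDeriv u z| ^ p ≤ (M * max 1 (2 * R)) ^ p :=
      (mul_le_of_le_one_left (by positivity) hψ).trans (by gcongr)
    have hv0 : 0 < 1 - (gNorm z / R) ^ c := hv₀.trans_le hv
    exact mul_le_mul_of_nonneg_right (mul_le_mul hg hv' (by positivity) (by positivity))
      (by positivity)

lemma rpow_le_two_rpow_abs {x : ℝ} (h1 : 1 ≤ x) (h2 : x ≤ 2) (e : ℝ) : x ^ e ≤ 2 ^ |e| :=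
  (Real.rpow_le_rpow_of_exponent_le h1 (le_abs_self e)).trans
    (Real.rpow_le_rpow (by linarith) h2 (abs_nonneg e))

lemma IsTest.lintegral_hardyGrad_lt_top (hR : 0 < R) (hp : 0 < p) (hpb : p ≤ b) (hc : 0 < c)
    (ha : a < n + 2) (hu : IsTest {z : GPt n | gNorm z < R} u) :
    ∫⁻ z, ENNReal.ofReal (hardyGrad p a b c R u z) < ⊤ := by
  obtain ⟨C, hC, hCu⟩ := hu.exists_hardyGrad_le (a := a) hR hp hpb hc
  have hint : IntegrableOn (fun s : ℝ => C * 2 ^ |p - a| * s ^ ((n : ℝ) + 2 - a - 1 + p))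
      (Set.Ioc 0 R) :=
    ((intervalIntegrable_iff_integrableOn_Ioc_of_le hR.le).1
      (intervalIntegral.intervalIntegrable_rpow' (by linarith))).const_mul _
  refine lintegral_lt_top_of_rays hu.measurable_hardyGrad.ennreal_ofReal
    (∫ s in Set.Ioc 0 R, C * 2 ^ |p - a| * s ^ ((n : ℝ) + 2 - a - 1 + p)) fun y hy => ?_
  have hρ : 0 < gNorm y := one_pos.trans_le hy.1
  have hy0 := (gNorm_pos_iff y).1 hρ
  rw [ofReal_integral_eq_lintegral_ofReal hint, ← Set.Ioc_union_Ioi_eq_Ioi hR.le,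
    lintegral_union measurableSet_Ioi (Set.Ioc_disjoint_Ioi le_rfl),
    setLIntegral_eq_zero measurableSet_Ioi, add_zero]
  · refine setLIntegral_mono' measurableSet_Ioc fun s hs => ?_
    have hs0 : 0 < s := hs.1
    rw [← ENNReal.ofReal_mul (by positivity)]
    refine ENNReal.ofReal_le_ofReal ?_
    have hz : gDil s y ≠ 0 := by
      rw [← gNorm_pos_iff, gNorm_gDil hs0.le]; positivity
    calc s ^ (n + 1) * hardyGrad p a b c R u (gDil s y)
        ≤ s ^ (n + 1) * (C * (s ^ (p - a) * gNorm y ^ (p - a))) := by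
          have := hCu _ hz
          rw [gNorm_gDil hs0.le, Real.mul_rpow hs0.le hρ.le] at this
          gcongr
      _ ≤ s ^ (n + 1) * (C * (s ^ (p - a) * 2 ^ |p - a|)) := by
          gcongr
          exact rpow_le_two_rpow_abs hy.1 hy.2 _
      _ = C * 2 ^ |p - a| * s ^ ((n : ℝ) + 2 - a - 1 + p) := by
          rw [Real.rpow_add hs0, ← pow_mul_rpow_neg hs0, sub_eq_neg_add p a, Real.rpow_add hs0]
          ring
  · intro s hs
    have hs : R < s := hs
    have hs0 : 0 < s := hR.trans hs
    have : gDil s y ∉ tsupport u := fun h => by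
      have h1 : gNorm (gDil s y) < R := hu.2.2 h
      rw [gNorm_gDil hs0.le] at h1
      nlinarith [hy.1]
    simp [hardyGrad_eq_zero hp (hu.1.differentiable (by simp)) this]
  · refine (ae_restrict_mem measurableSet_Ioc).mono fun s hs => ?_
    have : 0 < s := hs.1
    simp only [Pi.zero_apply]
    positivity

end Test

section Sharpness

/-- A smooth bump equal to `1` on `[2, 3]` and supported in `[1, 4]`. -/
def profileBump : ContDiffBump (5 / 2 : ℝ) := ⟨1 / 2, 3 / 2, by norm_num, by norm_num⟩

lemma profileBump_eq_one {x : ℝ} (h2 : 2 ≤ x) (h3 : x ≤ 3) : profileBump x = 1 := by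
  refine profileBump.one_of_mem_closedBall ?_
  rw [Metric.mem_closedBall, Real.dist_eq, abs_le]
  simp only [profileBump]
  constructor <;> linarith

lemma profileBump_eq_zero {x : ℝ} (h : x ≤ 1 ∨ 4 ≤ x) : profileBump x = 0 := by
  refine profileBump.zero_of_le_dist ?_
  rw [Real.dist_eq, le_abs]
  simp only [profileBump]
  rcases h with h | h
  · right; linarith
  · left; linarith

lemma exists_abs_deriv_profileBump_le : ∃ M, 0 ≤ M ∧ ∀ x, |deriv profileBump x| ≤ M := by
  obtain ⟨M, hM⟩ := profileBump.hasCompactSupport.deriv.exists_bound_of_continuous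
    (profileBump.contDiff.continuous_deriv (n := 1) le_rfl)
  exact ⟨M, (norm_nonneg _).trans (hM 0), hM⟩

/-- The virtual extremal `v^β`, cut off logarithmically near `v = 0`. -/
def cutoffProfile (β η v : ℝ) : ℝ :=
  if 0 < v then v ^ β * profileBump (-(η * Real.log v)) else 0

variable {β η : ℝ}

lemma cutoffProfile_of_pos {v : ℝ} (hv : 0 < v) :
    cutoffProfile β η v = v ^ β * profileBump (-(η * Real.log v)) := if_pos hv

lemma le_neg_mul_log_iff (hη : 0 < η) {v : ℝ} (hv : 0 < v) (j : ℝ) :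
    j ≤ -(η * Real.log v) ↔ v ≤ Real.exp (-(j / η)) := by
  rw [← Real.log_le_iff_le_exp hv, le_neg, le_neg (b := j / η), div_le_iff₀ hη, neg_mul, mul_comm,
    le_neg]

lemma neg_mul_log_le_iff (hη : 0 < η) {v : ℝ} (hv : 0 < v) (j : ℝ) :
    -(η * Real.log v) ≤ j ↔ Real.exp (-(j / η)) ≤ v := by
  rw [← Real.le_log_iff_exp_le hv, neg_le, neg_le (a := j / η), le_div_iff₀ hη, neg_mul, mul_comm,
    neg_le]

lemma cutoffProfile_eq_zero (hη : 0 < η) {v : ℝ}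
    (h : v ≤ Real.exp (-(4 / η)) ∨ Real.exp (-(1 / η)) ≤ v) : cutoffProfile β η v = 0 := by
  rcases le_or_gt v 0 with hv | hv
  · exact if_neg hv.not_gt
  · rw [cutoffProfile_of_pos hv, profileBump_eq_zero, mul_zero]
    rw [le_neg_mul_log_iff hη hv, neg_mul_log_le_iff hη hv]
    exact h.symm

lemma cutoffProfile_eventuallyEq_zero (hη : 0 < η) {v : ℝ}
    (h : v < Real.exp (-(4 / η)) ∨ Real.exp (-(1 / η)) < v) :
    cutoffProfile β η =ᶠ[nhds v] 0 := by
  rcases h with h | h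
  · filter_upwards [Iio_mem_nhds h] with w hw
    exact cutoffProfile_eq_zero hη (Or.inl (le_of_lt hw))
  · filter_upwards [Ioi_mem_nhds h] with w hw
    exact cutoffProfile_eq_zero hη (Or.inr (le_of_lt hw))

lemma contDiff_cutoffProfile (hη : 0 < η) : ContDiff ℝ (⊤ : ℕ∞) (cutoffProfile β η) := by
  rw [contDiff_iff_contDiffAt]
  intro v
  rcases le_or_gt v 0 with hv | hv
  · exact contDiffAt_const.congr_of_eventuallyEq
      (cutoffProfile_eventuallyEq_zero hη (Or.inl (hv.trans_lt (Real.exp_pos _))))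
  · have h1 : ContDiffAt ℝ (⊤ : ℕ∞)
        (fun v => v ^ β * profileBump (-(η * Real.log v))) v := by
      refine (contDiffAt_id.rpow_const_of_ne hv.ne').mul ?_
      exact profileBump.contDiff.contDiffAt.comp v
        (contDiffAt_const.mul (Real.contDiffAt_log.2 hv.ne')).neg
    refine h1.congr_of_eventuallyEq ?_
    filter_upwards [Ioi_mem_nhds hv] with w hw
    exact cutoffProfile_of_pos hw

lemma deriv_cutoffProfile_eq_zero (hη : 0 < η) {v : ℝ}
    (h : v < Real.exp (-(4 / η)) ∨ Real.exp (-(1 / η)) < v) :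
    deriv (cutoffProfile β η) v = 0 := by
  rw [(cutoffProfile_eventuallyEq_zero hη h).deriv_eq]
  exact deriv_const v 0

lemma mul_deriv_cutoffProfile {v : ℝ} (hv : 0 < v) :
    v * deriv (cutoffProfile β η) v = v ^ β * (β * profileBump (-(η * Real.log v)) -
      η * deriv profileBump (-(η * Real.log v))) := by
  have h1 : HasDerivAt (fun v : ℝ => v ^ β) (β * v ^ (β - 1)) v :=
    Real.hasDerivAt_rpow_const (Or.inl hv.ne')
  have h2 : HasDerivAt (fun v => -(η * Real.log v)) (-(η * v⁻¹)) v :=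
    ((Real.hasDerivAt_log hv.ne').const_mul η).neg
  have h3 : HasDerivAt profileBump (deriv profileBump (-(η * Real.log v)))
      (-(η * Real.log v)) :=
    ((profileBump.contDiff (n := 1)).differentiable one_ne_zero _).hasDerivAt
  have h4 : cutoffProfile β η =ᶠ[nhds v]
      fun v => v ^ β * profileBump (-(η * Real.log v)) := by
    filter_upwards [Ioi_mem_nhds hv] with w hw
    exact cutoffProfile_of_pos hw
  have h5 : HasDerivAt (fun v => v ^ β * profileBump (-(η * Real.log v)))
      (β * v ^ (β - 1) * profileBump (-(η * Real.log v)) +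
        v ^ β * (deriv profileBump (-(η * Real.log v)) * -(η * v⁻¹))) v :=
    h1.mul (HasDerivAt.comp (h₂ := profileBump) v h3 h2)
  rw [h4.deriv_eq, h5.deriv, Real.rpow_sub_one hv.ne']
  field_simp
  ring

lemma add_rpow_le_split {x y θ p : ℝ} (hx : 0 ≤ x) (hy : 0 ≤ y) (hθ : 0 < θ) (hp : 0 ≤ p) :
    (x + y) ^ p ≤ (1 + θ) ^ p * x ^ p + (1 + 1 / θ) ^ p * y ^ p := by
  rw [← Real.mul_rpow (by positivity) hx, ← Real.mul_rpow (by positivity) hy]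
  rcases le_total y (θ * x) with h | h
  · have : (x + y) ^ p ≤ ((1 + θ) * x) ^ p := by gcongr; linarith
    have h2 : 0 ≤ ((1 + 1 / θ) * y) ^ p := by positivity
    linarith
  · have : (x + y) ^ p ≤ ((1 + 1 / θ) * y) ^ p := by
      gcongr
      have : x ≤ y / θ := by rw [le_div_iff₀ hθ]; linarith
      calc x + y ≤ y / θ + y := by linarith
        _ = _ := by ring
    have h2 : 0 ≤ ((1 + θ) * x) ^ p := by positivity
    linarith

variable {p b c d R : ℝ}

/-- The point of the ray at which `1 - (s/R)^c = e^{-t}`. -/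
def rayPoint (c R t : ℝ) : ℝ := R * (1 - Real.exp (-t)) ^ (1 / c)

lemma one_sub_exp_neg_nonneg {t : ℝ} (ht : 0 ≤ t) : 0 ≤ 1 - Real.exp (-t) := by
  simpa using ht

lemma rayPoint_le_iff (hc : 0 < c) (hR : 0 < R) {s t : ℝ} (hs : 0 ≤ s) (ht : 0 ≤ t) :
    rayPoint c R t ≤ s ↔ rayDefect c R s ≤ Real.exp (-t) := by
  have h0 := one_sub_exp_neg_nonneg ht
  have h1 : rayPoint c R t ≤ s ↔ (1 - Real.exp (-t)) ^ (1 / c) ≤ s / R := by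
    unfold rayPoint; rw [le_div_iff₀ hR, mul_comm]
  rw [h1, one_div, Real.rpow_inv_le_iff_of_pos h0 (by positivity) hc]
  unfold rayDefect
  constructor <;> intro h <;> linarith

lemma le_rayPoint_iff (hc : 0 < c) (hR : 0 < R) {s t : ℝ} (hs : 0 ≤ s) (ht : 0 ≤ t) :
    s ≤ rayPoint c R t ↔ Real.exp (-t) ≤ rayDefect c R s := by
  have h0 := one_sub_exp_neg_nonneg ht
  have h1 : s ≤ rayPoint c R t ↔ s / R ≤ (1 - Real.exp (-t)) ^ (1 / c) := by
    unfold rayPoint; rw [div_le_iff₀ hR, mul_comm]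
  rw [h1, one_div, Real.le_rpow_inv_iff_of_pos (by positivity) h0 hc]
  unfold rayDefect
  constructor <;> intro h <;> linarith

lemma rayPoint_pos (hR : 0 < R) {t : ℝ} (ht : 0 < t) : 0 < rayPoint c R t := by
  have : 0 < 1 - Real.exp (-t) := by simpa using ht
  unfold rayPoint; positivity

lemma rayPoint_lt (hc : 0 < c) (hR : 0 < R) {t : ℝ} (ht : 0 ≤ t) : rayPoint c R t < R := by
  have : (1 - Real.exp (-t)) ^ (1 / c) < 1 :=
    Real.rpow_lt_one (one_sub_exp_neg_nonneg ht) (by simp [Real.exp_pos]) (by positivity)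
  unfold rayPoint
  nlinarith

lemma rayPoint_mono (hc : 0 < c) (hR : 0 < R) {t t' : ℝ} (ht : 0 ≤ t) (htt : t ≤ t') :
    rayPoint c R t ≤ rayPoint c R t' := by
  have := one_sub_exp_neg_nonneg ht
  unfold rayPoint
  gcongr

lemma rayDefect_rayPoint (hc : 0 < c) (hR : 0 < R) {t : ℝ} (ht : 0 < t) :
    rayDefect c R (rayPoint c R t) = Real.exp (-t) :=
  le_antisymm ((rayPoint_le_iff hc hR (rayPoint_pos hR ht).le ht.le).1 le_rfl)
    ((le_rayPoint_iff hc hR (rayPoint_pos hR ht).le ht.le).1 le_rfl)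

lemma lintegral_deriv_neg_log_rayDefect (hc : 0 < c) (hR : 0 < R) {t t' : ℝ} (ht : 0 < t)
    (htt : t ≤ t') :
    ∫⁻ s in Set.Icc (rayPoint c R t) (rayPoint c R t'),
        ENNReal.ofReal (c * (s / R) ^ c / s / rayDefect c R s) = ENNReal.ofReal (t' - t) := by
  have hle := rayPoint_mono hc hR ht.le htt
  have hpos : ∀ s ∈ Set.Icc (rayPoint c R t) (rayPoint c R t'), 0 < s ∧ 0 < rayDefect c R s :=
    fun s hs => by
      have h0 : 0 < s := (rayPoint_pos hR ht).trans_le hs.1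
      exact ⟨h0, rayDefect_pos hc h0.le (hs.2.trans_lt (rayPoint_lt hc hR (ht.le.trans htt)))⟩
  have hcont : ContinuousOn (fun s => c * (s / R) ^ c / s / rayDefect c R s)
      (Set.Icc (rayPoint c R t) (rayPoint c R t')) := by
    have h1 : Continuous fun s : ℝ => (s / R) ^ c :=
      (continuous_id.div_const R).rpow_const fun _ => Or.inr hc.le
    refine ((continuous_const.mul h1).continuousOn.div continuousOn_id
      fun s hs => (hpos s hs).1.ne').div (continuous_rayDefect hc).continuousOn
      fun s hs => (hpos s hs).2.ne'
  have hii := hcont.intervalIntegrable_of_Icc hle (μ := volume)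
  have hint : ∫ s in (rayPoint c R t)..(rayPoint c R t'),
      c * (s / R) ^ c / s / rayDefect c R s = t' - t := by
    rw [intervalIntegral.integral_eq_sub_of_hasDerivAt
      (f := fun s => -Real.log (rayDefect c R s)) (fun s hs => ?_) hii]
    · rw [rayDefect_rayPoint hc hR ht, rayDefect_rayPoint hc hR (ht.trans_le htt)]
      simp
    · rw [Set.uIcc_of_le hle] at hs
      refine ((hasDerivAt_rayDefect hR (hpos s hs).1).log (hpos s hs).2.ne').neg.congr_deriv ?_
      ring
  rw [← hint, intervalIntegral.integral_of_le hle, setLIntegral_congr Ioc_ae_eq_Icc.symm,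
    ofReal_integral_eq_lintegral_ofReal]
  · exact (intervalIntegrable_iff_integrableOn_Ioc_of_le hle).1 hii
  · refine (ae_restrict_mem measurableSet_Ioc).mono fun s hs => ?_
    obtain ⟨h1, h2⟩ := hpos s (Set.Ioc_subset_Icc_self hs)
    simp only [Pi.zero_apply]
    positivity

lemma rayLayer_bounds (hc : 0 < c) (hd : 0 < d) (hR : 0 < R) {s t : ℝ} (ht : 1 ≤ t)
    (hs : rayPoint c R t ≤ s) (hsR : s < R) :
    s ^ (d - 1) * (rayDefect c R s)⁻¹ ≤
        2 * R ^ d / c * (c * (s / R) ^ c / s / rayDefect c R s) ∧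
      R ^ d * (1 / 2) ^ (d / c) / c * (c * (s / R) ^ c / s / rayDefect c R s) ≤
        s ^ (d - 1) * (rayDefect c R s)⁻¹ := by
  have hs0 : 0 < s := (rayPoint_pos hR (by linarith)).trans_le hs
  have hv := rayDefect_pos hc hs0.le hsR
  have hτ : 1 / 2 ≤ (s / R) ^ c := by
    have h1 := (rayPoint_le_iff hc hR hs0.le (by linarith)).1 hs
    have h2 : Real.exp (-t) ≤ Real.exp (-1) := Real.exp_le_exp.2 (by linarith)
    have h3 : Real.exp (-1) ≤ 1 / 2 := by
      rw [Real.exp_neg, ← one_div]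
      exact one_div_le_one_div_of_le two_pos (by linarith [Real.add_one_le_exp (1 : ℝ)])
    unfold rayDefect at h1
    linarith
  have hτ1 : (s / R) ^ c ≤ 1 := Real.rpow_le_one (by positivity) ((div_le_one hR).2 hsR.le) hc.le
  have e1 : s ^ d = R ^ d * ((s / R) ^ c) ^ (d / c) := by
    rw [← Real.rpow_mul (by positivity), mul_div_cancel₀ _ hc.ne', Real.div_rpow hs0.le hR.le]
    field_simp
  have hRd : 0 < R ^ d := by positivity
  have e2 : s ^ (d - 1) * (rayDefect c R s)⁻¹ = R ^ d * ((s / R) ^ c) ^ (d / c) *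
      (s * rayDefect c R s)⁻¹ := by
    rw [← e1, Real.rpow_sub_one hs0.ne']; field_simp
  have e3 : c * (s / R) ^ c / s / rayDefect c R s =
      c * (s / R) ^ c * (s * rayDefect c R s)⁻¹ := by field_simp
  have hpow1 : ((s / R) ^ c) ^ (d / c) ≤ 1 :=
    Real.rpow_le_one (by positivity) hτ1 (by positivity)
  have hpow2 : (1 / 2 : ℝ) ^ (d / c) ≤ ((s / R) ^ c) ^ (d / c) := by gcongr
  rw [e2, e3]
  constructor
  · calc _ ≤ R ^ d * 1 * (s * rayDefect c R s)⁻¹ := by gcongr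
      _ ≤ R ^ d * (2 * (s / R) ^ c) * (s * rayDefect c R s)⁻¹ := by gcongr; linarith
      _ = _ := by field_simp
  · calc _ = R ^ d * ((1 / 2) ^ (d / c) * (s / R) ^ c) * (s * rayDefect c R s)⁻¹ := by field_simp
      _ ≤ R ^ d * (((s / R) ^ c) ^ (d / c) * 1) * (s * rayDefect c R s)⁻¹ := by gcongr
      _ = _ := by ring

lemma lintegral_rayLayer_le (hc : 0 < c) (hd : 0 < d) (hR : 0 < R) {t t' : ℝ} (ht : 1 ≤ t)
    (htt : t ≤ t') :
    ∫⁻ s in Set.Icc (rayPoint c R t) (rayPoint c R t'),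
        ENNReal.ofReal (s ^ (d - 1) * (rayDefect c R s)⁻¹) ≤
      ENNReal.ofReal (2 * R ^ d / c * (t' - t)) := by
  rw [ENNReal.ofReal_mul (by positivity),
    ← lintegral_deriv_neg_log_rayDefect hc hR (by linarith) htt,
    ← lintegral_const_mul' _ _ ENNReal.ofReal_ne_top]
  refine setLIntegral_mono' measurableSet_Icc fun s hs => ?_
  rw [← ENNReal.ofReal_mul (by positivity)]
  exact ENNReal.ofReal_le_ofReal (rayLayer_bounds hc hd hR ht hs.1
    (hs.2.trans_lt (rayPoint_lt hc hR (by linarith)))).1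

lemma le_lintegral_rayLayer (hc : 0 < c) (hd : 0 < d) (hR : 0 < R) {t t' : ℝ} (ht : 1 ≤ t)
    (htt : t ≤ t') :
    ENNReal.ofReal (R ^ d * (1 / 2) ^ (d / c) / c * (t' - t)) ≤
      ∫⁻ s in Set.Icc (rayPoint c R t) (rayPoint c R t'),
        ENNReal.ofReal (s ^ (d - 1) * (rayDefect c R s)⁻¹) := by
  rw [ENNReal.ofReal_mul (by positivity),
    ← lintegral_deriv_neg_log_rayDefect hc hR (by linarith) htt,
    ← lintegral_const_mul' _ _ ENNReal.ofReal_ne_top]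
  refine setLIntegral_mono' measurableSet_Icc fun s hs => ?_
  rw [← ENNReal.ofReal_mul (by positivity)]
  exact ENNReal.ofReal_le_ofReal (rayLayer_bounds hc hd hR ht hs.1
    (hs.2.trans_lt (rayPoint_lt hc hR (by linarith)))).2

lemma rayLayer_le_mul_rayLayer (hc : 0 < c) (hd : 0 < d) (hR : 0 < R) (hη : 0 < η)
    (hη1 : η ≤ 1) :
    ∫⁻ s in Set.Icc (rayPoint c R (1 / η)) (rayPoint c R (4 / η)),
        ENNReal.ofReal (s ^ (d - 1) * (rayDefect c R s)⁻¹) ≤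
      ENNReal.ofReal (6 * 2 ^ (d / c)) *
        ∫⁻ s in Set.Icc (rayPoint c R (2 / η)) (rayPoint c R (3 / η)),
          ENNReal.ofReal (s ^ (d - 1) * (rayDefect c R s)⁻¹) := by
  have h1 : 1 ≤ 1 / η := (one_le_div hη).2 hη1
  have h2 : 1 ≤ 2 / η := (one_le_div hη).2 (by linarith)
  refine (lintegral_rayLayer_le hc hd hR h1 (by gcongr; norm_num)).trans ?_
  refine le_trans (le_of_eq ?_)
    (mul_le_mul_right (le_lintegral_rayLayer hc hd hR h2 (by gcongr; norm_num)) _)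
  rw [← ENNReal.ofReal_mul (by positivity)]
  congr 1
  have h3 : (1 / 2 : ℝ) ^ (d / c) = (2 ^ (d / c))⁻¹ := by
    rw [one_div, Real.inv_rpow two_pos.le]
  rw [h3]
  field_simp
  norm_num

lemma rayWeight_mul_rpow (hp : 0 < p) {s : ℝ} (hv : 0 < rayDefect c R s) {x : ℝ} (hx : 0 ≤ x) :
    rayWeight b c d R s * (rayDefect c R s ^ ((b - 1) / p) * x) ^ p =
      s ^ (d - 1) * (rayDefect c R s)⁻¹ * x ^ p := by
  unfold rayWeight
  rw [Real.mul_rpow (by positivity) hx, ← Real.rpow_mul hv.le, div_mul_cancel₀ _ hp.ne',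
    Real.rpow_sub_one hv.ne', Real.rpow_neg hv.le]
  field_simp

lemma rayWeight_mul_cutoffProfile (hp : 0 < p) {s : ℝ} (hv : 0 < rayDefect c R s) :
    rayWeight b c d R s * |cutoffProfile ((b - 1) / p) η (rayDefect c R s)| ^ p =
      s ^ (d - 1) * (rayDefect c R s)⁻¹ *
        profileBump (-(η * Real.log (rayDefect c R s))) ^ p := by
  rw [cutoffProfile_of_pos hv, abs_mul, abs_of_nonneg (Real.rpow_nonneg hv.le _),
    abs_of_nonneg profileBump.nonneg, rayWeight_mul_rpow hp hv profileBump.nonneg]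

lemma deriv_cutoffProfile_ray (hη : 0 < η) (hR : 0 < R) {s : ℝ} (hs : 0 < s) :
    deriv (fun r => cutoffProfile β η (rayDefect c R r)) s =
      deriv (cutoffProfile β η) (rayDefect c R s) * (-(c * (s / R) ^ c / s)) :=
  ((((contDiff_cutoffProfile hη).differentiable (by simp)) _).hasDerivAt.comp s
    (hasDerivAt_rayDefect hR hs)).deriv

lemma rayWeight_mul_deriv_cutoffProfile_le (hp : 0 < p) (hb : 1 < b) (hc : 0 < c) (hη : 0 < η)
    {M : ℝ} (hM0 : 0 ≤ M) (hM : ∀ x, |deriv profileBump x| ≤ M) {θ : ℝ} (hθ : 0 < θ)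
    (hR : 0 < R) {s : ℝ} (hs : 0 < s) (hsR : s < R) :
    rayWeight b c d R s * (s * rayDefect c R s *
        |deriv (fun r => cutoffProfile ((b - 1) / p) η (rayDefect c R r)) s|) ^ p ≤
      (1 + θ) ^ p * ((b - 1) * c / p) ^ p * (rayWeight b c d R s *
        |cutoffProfile ((b - 1) / p) η (rayDefect c R s)| ^ p) +
      (1 + 1 / θ) ^ p * (c * (η * M)) ^ p * (s ^ (d - 1) * (rayDefect c R s)⁻¹) := by
  have hv := rayDefect_pos hc hs.le hsR
  set v := rayDefect c R s with hvdef
  set β := (b - 1) / p with hβdef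
  have hβ : 0 < β := div_pos (by linarith) hp
  set X := profileBump (-(η * Real.log v)) with hX
  have hX0 : 0 ≤ X := profileBump.nonneg
  have hτ0 : 0 ≤ (s / R) ^ c := by positivity
  have hτ1 : (s / R) ^ c ≤ 1 := Real.rpow_le_one (by positivity) ((div_le_one hR).2 hsR.le) hc.le
  have hdiff : |β * X - η * deriv profileBump (-(η * Real.log v))| ≤ β * X + η * M := by
    refine (abs_sub _ _).trans ?_
    rw [abs_of_nonneg (by positivity : 0 ≤ β * X), abs_mul, abs_of_pos hη]
    gcongr
    exact hM _
  have h1 : s * v * |deriv (fun r => cutoffProfile β η (rayDefect c R r)) s| ≤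
      v ^ β * (β * c * X + c * (η * M)) := by
    rw [deriv_cutoffProfile_ray hη hR hs, ← hvdef, abs_mul, abs_neg,
      abs_of_nonneg (by positivity : 0 ≤ c * (s / R) ^ c / s)]
    calc _ = c * (s / R) ^ c * |v * deriv (cutoffProfile β η) v| := by
          rw [abs_mul, abs_of_pos hv]; field_simp
      _ ≤ c * 1 * (v ^ β * (β * X + η * M)) := by
          rw [mul_deriv_cutoffProfile hv, abs_mul, abs_of_nonneg (Real.rpow_nonneg hv.le β)]
          gcongr
      _ = _ := by ring
  have hW : 0 ≤ rayWeight b c d R s := rayWeight_nonneg hc hs.le hsR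
  have hw : 0 ≤ s ^ (d - 1) * v⁻¹ := by positivity
  calc _ ≤ rayWeight b c d R s * (v ^ β * (β * c * X + c * (η * M))) ^ p := by
        gcongr
    _ = s ^ (d - 1) * v⁻¹ * (β * c * X + c * (η * M)) ^ p :=
        rayWeight_mul_rpow hp hv (by positivity)
    _ ≤ s ^ (d - 1) * v⁻¹ * ((1 + θ) ^ p * (β * c * X) ^ p +
          (1 + 1 / θ) ^ p * (c * (η * M)) ^ p) := by
        gcongr
        exact add_rpow_le_split (by positivity) (by positivity) hθ hp.le
    _ = _ := by
        rw [rayWeight_mul_cutoffProfile hp hv, ← hvdef, ← hX,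
          Real.mul_rpow (by positivity) hX0, hβdef, div_mul_eq_mul_div]
        ring

lemma lintegral_cutoffProfile_ray_le (hp : 0 < p) (hb : 1 < b) (hc : 0 < c) (hd : 0 < d)
    (hη : 0 < η) (hη1 : η ≤ 1) {M : ℝ} (hM0 : 0 ≤ M) (hM : ∀ x, |deriv profileBump x| ≤ M)
    {θ : ℝ} (hθ : 0 < θ) (hR : 0 < R) :
    ∫⁻ s in Set.Ioi (0 : ℝ), ENNReal.ofReal (rayWeight b c d R s * (s * rayDefect c R s *
        |deriv (fun r => cutoffProfile ((b - 1) / p) η (rayDefect c R r)) s|) ^ p) ≤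
      ENNReal.ofReal ((1 + θ) ^ p * ((b - 1) * c / p) ^ p +
          (1 + 1 / θ) ^ p * (c * (η * M)) ^ p * (6 * 2 ^ (d / c))) *
        ∫⁻ s in Set.Ioi (0 : ℝ), ENNReal.ofReal
          (rayWeight b c d R s * |cutoffProfile ((b - 1) / p) η (rayDefect c R s)| ^ p) := by
  have hbc : 0 < (b - 1) * c := mul_pos (by linarith) hc
  set β := (b - 1) / p with hβdef
  set K := (1 + θ) ^ p * ((b - 1) * c / p) ^ p with hK
  set A := (1 + 1 / θ) ^ p * (c * (η * M)) ^ p with hA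
  have hK0 : 0 ≤ K := by positivity
  have hA0 : 0 ≤ A := by positivity
  set P : ℝ → ENNReal := fun s =>
    ENNReal.ofReal (rayWeight b c d R s * |cutoffProfile β η (rayDefect c R s)| ^ p) with hP
  set L : ℝ → ENNReal := fun s =>
    ENNReal.ofReal (s ^ (d - 1) * (rayDefect c R s)⁻¹) with hL
  have hvm : Measurable (rayDefect c R) := (continuous_rayDefect hc).measurable
  have hPm : Measurable P := by
    have h1 : Measurable (cutoffProfile β η) := (contDiff_cutoffProfile hη).continuous.measurable
    have h2 := h1.comp hvm
    simp only [Function.comp_def] at h2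
    simp only [hP, rayWeight]
    fun_prop
  have hlt : ∀ j : ℝ, 0 < j → rayPoint c R (j / η) < R := fun j hj =>
    rayPoint_lt hc hR (by positivity)
  have hpos : ∀ j : ℝ, 0 < j → 0 < rayPoint c R (j / η) := fun j hj =>
    rayPoint_pos hR (by positivity)
  have hpt : ∀ s ∈ Set.Ioi (0 : ℝ), ENNReal.ofReal (rayWeight b c d R s *
      (s * rayDefect c R s * |deriv (fun r => cutoffProfile β η (rayDefect c R r)) s|) ^ p) ≤
      ENNReal.ofReal K * P s + (Set.Icc (rayPoint c R (1 / η)) (rayPoint c R (4 / η))).indicator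
        (fun s => ENNReal.ofReal A * L s) s := by
    intro s hs
    have hs : 0 < s := hs
    by_cases h : s ∈ Set.Icc (rayPoint c R (1 / η)) (rayPoint c R (4 / η))
    · rw [Set.indicator_of_mem h, ← ENNReal.ofReal_mul hK0, ← ENNReal.ofReal_mul hA0]
      refine le_trans (ENNReal.ofReal_le_ofReal ?_) ENNReal.ofReal_add_le
      exact rayWeight_mul_deriv_cutoffProfile_le hp hb hc hη hM0 hM hθ hR hs
        (h.2.trans_lt (hlt 4 (by norm_num)))
    · have h1 : deriv (cutoffProfile β η) (rayDefect c R s) = 0 := by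
        refine deriv_cutoffProfile_eq_zero hη ?_
        by_contra! h2
        exact h ⟨(rayPoint_le_iff hc hR hs.le (by positivity)).2 h2.2,
          (le_rayPoint_iff hc hR hs.le (by positivity)).2 h2.1⟩
      rw [deriv_cutoffProfile_ray hη hR hs, h1]
      simp [Real.zero_rpow hp.ne']
  have hcore : ∫⁻ s in Set.Icc (rayPoint c R (2 / η)) (rayPoint c R (3 / η)), L s ≤
      ∫⁻ s in Set.Ioi (0 : ℝ), P s := by
    refine le_trans (setLIntegral_mono' measurableSet_Icc fun s hs => ?_)
      (lintegral_mono_set fun s hs => (hpos 2 two_pos).trans_le hs.1)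
    have hs0 : 0 < s := (hpos 2 two_pos).trans_le hs.1
    have hv := rayDefect_pos hc hs0.le (hs.2.trans_lt (hlt 3 (by norm_num)))
    refine ENNReal.ofReal_le_ofReal ?_
    rw [rayWeight_mul_cutoffProfile hp hv, profileBump_eq_one, Real.one_rpow, mul_one]
    · exact (le_neg_mul_log_iff hη hv 2).2 ((rayPoint_le_iff hc hR hs0.le (by positivity)).1 hs.1)
    · exact (neg_mul_log_le_iff hη hv 3).2 ((le_rayPoint_iff hc hR hs0.le (by positivity)).1 hs.2)
  have hsub : Set.Icc (rayPoint c R (1 / η)) (rayPoint c R (4 / η)) ∩ Set.Ioi 0 =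
      Set.Icc (rayPoint c R (1 / η)) (rayPoint c R (4 / η)) :=
    Set.inter_eq_left.2 fun s hs => (hpos 1 one_pos).trans_le hs.1
  calc _ ≤ _ := setLIntegral_mono' measurableSet_Ioi hpt
    _ = ENNReal.ofReal K * (∫⁻ s in Set.Ioi (0 : ℝ), P s) + ENNReal.ofReal A *
          ∫⁻ s in Set.Icc (rayPoint c R (1 / η)) (rayPoint c R (4 / η)), L s := by
        rw [lintegral_add_left (hPm.const_mul _), lintegral_const_mul' _ _ ENNReal.ofReal_ne_top,
          setLIntegral_indicator measurableSet_Icc, hsub,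
          lintegral_const_mul' _ _ ENNReal.ofReal_ne_top]
    _ ≤ ENNReal.ofReal K * (∫⁻ s in Set.Ioi (0 : ℝ), P s) + ENNReal.ofReal A *
          (ENNReal.ofReal (6 * 2 ^ (d / c)) * ∫⁻ s in Set.Ioi (0 : ℝ), P s) := by
        gcongr
        exact (rayLayer_le_mul_rayLayer hc hd hR hη hη1).trans (by gcongr)
    _ = _ := by
        rw [ENNReal.ofReal_add hK0 (by positivity), ENNReal.ofReal_mul hA0]
        ring

end Sharpness

section Extremal

variable {n : ℕ} {p a b c R β η : ℝ}

/-- The cut-off virtual extremal, as a radial function on the Grushin space. -/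
def gCutoff (β η c R : ℝ) (z : GPt n) : ℝ := cutoffProfile β η (rayDefect c R (gNorm z))

lemma contDiffAt_gNorm {z : GPt n} (hz : z ≠ 0) :
    ContDiffAt ℝ (⊤ : ℕ∞) (gNorm : GPt n → ℝ) z := by
  have h1 : ContDiff ℝ (⊤ : ℕ∞) fun z : GPt n => (‖z.1‖ ^ 2) ^ 2 + 4 * z.2 ^ 2 :=
    (((contDiff_norm_sq ℝ).comp contDiff_fst).pow 2).add (contDiff_const.mul (contDiff_snd.pow 2))
  have h2 : (fun z : GPt n => (‖z.1‖ ^ 2) ^ 2 + 4 * z.2 ^ 2) =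
      fun z => ‖z.1‖ ^ 4 + 4 * z.2 ^ 2 := by
    ext z; ring
  rw [h2] at h1
  have h3 : ‖z.1‖ ^ 4 + 4 * z.2 ^ 2 ≠ 0 := by
    rw [← gNorm_pow_four]
    exact pow_ne_zero 4 ((gNorm_pos_iff z).2 hz).ne'
  exact h1.contDiffAt.rpow_const_of_ne h3

lemma contDiff_gCutoff (hc : 0 < c) (hR : 0 < R) (hη : 0 < η) :
    ContDiff ℝ (⊤ : ℕ∞) (gCutoff β η c R : GPt n → ℝ) := by
  rw [contDiff_iff_contDiffAt]
  intro z
  rcases eq_or_ne z 0 with rfl | hz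
  · refine (contDiffAt_const (c := (0 : ℝ))).congr_of_eventuallyEq ?_
    have h1 : Filter.Tendsto (fun z : GPt n => rayDefect c R (gNorm z)) (nhds 0) (nhds 1) := by
      have h2 := ((continuous_rayDefect (R := R) hc).comp (continuous_gNorm (n := n))).tendsto 0
      simpa [Function.comp_def, rayDefect, (gNorm_eq_zero_iff (0 : GPt n)).2 rfl,
        Real.zero_rpow hc.ne'] using h2
    have h2 : Real.exp (-(1 / η)) < 1 := by simpa using hη
    exact h1.eventually (cutoffProfile_eventuallyEq_zero hη (Or.inr h2))
  · have hρ := (gNorm_pos_iff z).2 hz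
    refine (contDiff_cutoffProfile hη).contDiffAt.comp z (contDiffAt_const.sub ?_)
    exact ((contDiffAt_gNorm hz).div_const R).rpow_const_of_ne (by positivity)

lemma isTest_gCutoff (hc : 0 < c) (hR : 0 < R) (hη : 0 < η) :
    IsTest {z : GPt n | gNorm z < R} (gCutoff β η c R) := by
  have hcl : IsClosed {z : GPt n | Real.exp (-(4 / η)) ≤ rayDefect c R (gNorm z)} :=
    isClosed_le continuous_const ((continuous_rayDefect hc).comp continuous_gNorm)
  have hsub : tsupport (gCutoff β η c R) ⊆
      {z : GPt n | Real.exp (-(4 / η)) ≤ rayDefect c R (gNorm z)} := by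
    refine closure_minimal (fun z hz => ?_) hcl
    by_contra h
    exact hz (cutoffProfile_eq_zero hη (Or.inl (not_le.1 h).le))
  have hlt : tsupport (gCutoff β η c R) ⊆ {z : GPt n | gNorm z < R} := by
    intro z hz
    have h1 : z ∈ {z : GPt n | Real.exp (-(4 / η)) ≤ rayDefect c R (gNorm z)} := hsub hz
    exact ((le_rayPoint_iff hc hR (gNorm_nonneg z) (by positivity)).2 h1).trans_lt
      (rayPoint_lt hc hR (by positivity))
  refine ⟨contDiff_gCutoff hc hR hη, ?_, hlt⟩
  exact (isCompact_gNorm_le R).of_isClosed_subset (isClosed_tsupport _)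
    fun z hz => (le_of_lt (hlt hz) : gNorm z ≤ R)

lemma gCutoff_gDil {s : ℝ} (hs : 0 ≤ s) (y : GPt n) :
    gCutoff β η c R (gDil s y) = cutoffProfile β η (rayDefect c (R / gNorm y) s) := by
  unfold gCutoff
  rw [gNorm_gDil hs, rayDefect_div_gNorm]
  rfl

lemma lintegral_hardyGrad_gCutoff_le (hR : 0 < R) (hp : 0 < p) (hb : 1 < b) (hc : 0 < c)
    (ha : a < n + 2) (hη : 0 < η) (hη1 : η ≤ 1) {M : ℝ} (hM0 : 0 ≤ M)
    (hM : ∀ x, |deriv profileBump x| ≤ M) {θ : ℝ} (hθ : 0 < θ) {K : ℝ}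
    (hK : (1 + θ) ^ p * ((b - 1) * c / p) ^ p +
      (1 + 1 / θ) ^ p * (c * (η * M)) ^ p * (6 * 2 ^ (((n : ℝ) + 2 - a) / c)) ≤ K) :
    ∫⁻ z : GPt n, ENNReal.ofReal (hardyGrad p a b c R (gCutoff ((b - 1) / p) η c R) z) ≤
      ∫⁻ z : GPt n, ENNReal.ofReal (K * hardyPot p a b c R (gCutoff ((b - 1) / p) η c R) z) := by
  have hu := isTest_gCutoff (n := n) (β := (b - 1) / p) hc hR hη
  have hK0 : 0 ≤ K := by
    have : 0 ≤ (b - 1) * c / p := div_nonneg (mul_nonneg (by linarith) hc.le) hp.le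
    exact le_trans (by positivity) hK
  refine lintegral_mono_of_rays hu.measurable_hardyGrad.ennreal_ofReal
    (hu.measurable_hardyPot.const_mul _).ennreal_ofReal fun y hy => ?_
  have hρ := (gNorm_pos_iff y).2 hy
  rw [hu.lintegral_hardyPot_ray hp hc hy, hu.lintegral_hardyGrad_ray hp hc hy]
  refine mul_le_mul_right ?_ _
  have hray := lintegral_cutoffProfile_ray_le hp hb hc (sub_pos.2 ha) hη hη1 hM0 hM hθ
    (div_pos hR hρ)
  refine le_trans (le_of_eq ?_) (hray.trans ((mul_le_mul_left
    (ENNReal.ofReal_le_ofReal hK) _).trans (le_of_eq ?_)))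
  · refine setLIntegral_congr_fun measurableSet_Ioi fun s hs => ?_
    have h1 : (fun r => gCutoff ((b - 1) / p) η c R (gDil r y)) =ᶠ[nhds s]
        fun r => cutoffProfile ((b - 1) / p) η (rayDefect c (R / gNorm y) r) := by
      filter_upwards [Ioi_mem_nhds hs] with r hr
      exact gCutoff_gDil (le_of_lt hr) y
    rw [h1.deriv_eq]
  · rw [← lintegral_const_mul' _ _ ENNReal.ofReal_ne_top]
    refine setLIntegral_congr_fun measurableSet_Ioi fun s hs => ?_
    simp only [gCutoff_gDil (le_of_lt hs), ENNReal.ofReal_mul hK0]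

lemma lintegral_hardyPot_gCutoff_pos (hn : n ≠ 0) (hR : 0 < R) (hc : 0 < c)
    (hη : 0 < η) :
    0 < ∫⁻ z : GPt n, ENNReal.ofReal (hardyPot p a b c R (gCutoff β η c R) z) := by
  have hu := isTest_gCutoff (n := n) (β := β) hc hR hη
  rw [lintegral_pos_iff_support hu.measurable_hardyPot.ennreal_ofReal]
  have hopen : IsOpen {z : GPt n | gCutoff β η c R z ≠ 0 ∧ z.1 ≠ 0} :=
    (isOpen_ne_fun hu.1.continuous continuous_const).inter
      (isOpen_ne_fun continuous_fst continuous_const)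
  have hne : {z : GPt n | gCutoff β η c R z ≠ 0 ∧ z.1 ≠ 0}.Nonempty := by
    have ht : 0 < 2 / η := by positivity
    have h0 := rayPoint_pos (c := c) hR ht
    refine ⟨(EuclideanSpace.single ⟨0, Nat.pos_of_ne_zero hn⟩ (rayPoint c R (2 / η)), 0), ?_, ?_⟩
    · have h1 : gNorm ((EuclideanSpace.single ⟨0, Nat.pos_of_ne_zero hn⟩
          (rayPoint c R (2 / η)), 0) : GPt n) = rayPoint c R (2 / η) := by
        refine (pow_left_inj₀ (gNorm_nonneg _) h0.le (n := 4) (by norm_num)).1 ?_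
        rw [gNorm_pow_four]
        simp [abs_of_pos h0]
      unfold gCutoff
      rw [h1, rayDefect_rayPoint hc hR ht, cutoffProfile_of_pos (Real.exp_pos _),
        profileBump_eq_one, mul_one]
      · exact (Real.rpow_pos_of_pos (Real.exp_pos _) _).ne'
      · rw [Real.log_exp]; field_simp; norm_num
      · rw [Real.log_exp]; field_simp; norm_num
    · simpa using h0.ne'
  refine (hopen.measure_pos volume hne).trans_le (measure_mono fun z hz => ?_)
  have hz1 : 0 < ‖z.1‖ := norm_pos_iff.2 hz.2
  have hρ : 0 < gNorm z := hz1.trans_le (norm_fst_le_gNorm z)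
  have hv := gDefect_pos hc (hu.2.2 (subset_tsupport _ hz.1))
  have hψ : 0 < gPsi z := by unfold gPsi; positivity
  have habs : 0 < |gCutoff β η c R z| := abs_pos.2 hz.1
  have hpos : 0 < hardyPot p a b c R (gCutoff β η c R) z := by
    unfold hardyPot; positivity
  simpa using hpos

lemma exists_cutoff_parameters (hp : 0 < p) {K₀ K A M : ℝ} (hK : K₀ < K) :
    ∃ θ η : ℝ, 0 < θ ∧ 0 < η ∧ η ≤ 1 ∧
      (1 + θ) ^ p * K₀ + (1 + 1 / θ) ^ p * (c * (η * M)) ^ p * A ≤ K := by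
  have h1 : Filter.Tendsto (fun θ : ℝ => (1 + θ) ^ p * K₀) (nhds 0) (nhds K₀) := by
    have : Continuous fun θ : ℝ => (1 + θ) ^ p * K₀ :=
      ((continuous_const.add continuous_id).rpow_const fun _ => Or.inr hp.le).mul continuous_const
    simpa using this.tendsto 0
  obtain ⟨θ, hθK, hθ⟩ := (((h1.eventually (gt_mem_nhds hK)).filter_mono
    nhdsWithin_le_nhds).and (self_mem_nhdsWithin (s := Set.Ioi (0 : ℝ)))).exists
  have h2 : Filter.Tendsto (fun η : ℝ => (1 + θ) ^ p * K₀ +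
      (1 + 1 / θ) ^ p * (c * (η * M)) ^ p * A) (nhds 0) (nhds ((1 + θ) ^ p * K₀)) := by
    have : Continuous fun η : ℝ => (1 + θ) ^ p * K₀ +
        (1 + 1 / θ) ^ p * (c * (η * M)) ^ p * A :=
      continuous_const.add ((continuous_const.mul ((continuous_const.mul
        (continuous_id.mul continuous_const)).rpow_const fun _ => Or.inr hp.le)).mul
        continuous_const)
    simpa [Real.zero_rpow hp.ne'] using this.tendsto 0
  obtain ⟨η, ⟨hηK, hη1⟩, hη⟩ := ((((h2.eventually (gt_mem_nhds hθK)).and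
    (gt_mem_nhds one_pos)).filter_mono nhdsWithin_le_nhds).and
    (self_mem_nhdsWithin (s := Set.Ioi (0 : ℝ)))).exists
  exact ⟨θ, η, hθ, hη, le_of_lt hη1, le_of_lt hηK⟩

variable {u : GPt n → ℝ}

lemma IsTest.setIntegral_hardyPot (hp : 0 < p) (hc : 0 < c)
    (hu : IsTest {z : GPt n | gNorm z < R} u) :
    ∫ z in {z : GPt n | gNorm z < R}, hardyPot p a b c R u z =
      (∫⁻ z, ENNReal.ofReal (hardyPot p a b c R u z)).toReal := by
  rw [setIntegral_eq_integral_of_forall_compl_eq_zero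
    fun z hz => hardyPot_eq_zero hp fun h => hz (hu.2.2 h)]
  exact integral_eq_lintegral_of_nonneg_ae (ae_of_all _ (hu.hardyPot_nonneg hp hc))
    hu.measurable_hardyPot.aestronglyMeasurable

lemma IsTest.setIntegral_hardyGrad (hp : 0 < p) (hc : 0 < c)
    (hu : IsTest {z : GPt n | gNorm z < R} u) :
    ∫ z in {z : GPt n | gNorm z < R}, hardyGrad p a b c R u z =
      (∫⁻ z, ENNReal.ofReal (hardyGrad p a b c R u z)).toReal := by
  rw [setIntegral_eq_integral_of_forall_compl_eq_zero
    fun z hz => hardyGrad_eq_zero hp (hu.1.differentiable (by simp)) fun h => hz (hu.2.2 h)]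
  exact integral_eq_lintegral_of_nonneg_ae (ae_of_all _ (hu.hardyGrad_nonneg hp hc))
    hu.measurable_hardyGrad.aestronglyMeasurable

lemma lintegral_ofReal_const_mul {f : GPt n → ℝ} {K : ℝ} (hK : 0 ≤ K) :
    ∫⁻ z, ENNReal.ofReal (K * f z) = ENNReal.ofReal K * ∫⁻ z, ENNReal.ofReal (f z) := by
  simp only [ENNReal.ofReal_mul hK]
  exact lintegral_const_mul' _ _ ENNReal.ofReal_ne_top

lemma IsTest.lintegral_hardyPot_lt_top (hR : 0 < R) (hp : 1 < p) (hpb : p ≤ b) (hc : 0 < c)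
    (ha : a < n + 2) (habc : (b - 1) * c ≤ n + 2 - a)
    (hu : IsTest {z : GPt n | gNorm z < R} u) :
    ∫⁻ z, ENNReal.ofReal (hardyPot p a b c R u z) < ⊤ := by
  have hb : 1 < b := hp.trans_le hpb
  have hp0 : 0 < p := one_pos.trans hp
  have hK : 0 < ((b - 1) * c / p) ^ p :=
    Real.rpow_pos_of_pos (div_pos (mul_pos (by linarith) hc) hp0) _
  have h1 := (hu.lintegral_hardyPot_le hR hp hb hc habc).trans_lt
    (hu.lintegral_hardyGrad_lt_top hR hp0 hpb hc ha)
  rw [lintegral_ofReal_const_mul hK.le] at h1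
  exact ENNReal.lt_top_of_mul_ne_top_right h1.ne (by simpa using hK)

lemma IsTest.mul_setIntegral_hardyPot_le (hR : 0 < R) (hp : 1 < p) (hpb : p ≤ b) (hc : 0 < c)
    (ha : a < n + 2) (habc : (b - 1) * c ≤ n + 2 - a)
    (hu : IsTest {z : GPt n | gNorm z < R} u) :
    ((b - 1) * c / p) ^ p * ∫ z in {z : GPt n | gNorm z < R}, hardyPot p a b c R u z ≤
      ∫ z in {z : GPt n | gNorm z < R}, hardyGrad p a b c R u z := by
  have hb : 1 < b := hp.trans_le hpb
  have hp0 : 0 < p := one_pos.trans hp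
  have hK : 0 ≤ ((b - 1) * c / p) ^ p :=
    Real.rpow_nonneg (div_nonneg (mul_nonneg (by linarith) hc.le) hp0.le) _
  rw [hu.setIntegral_hardyPot hp0 hc, hu.setIntegral_hardyGrad hp0 hc]
  have h1 := hu.lintegral_hardyPot_le hR hp hb hc habc
  rw [lintegral_ofReal_const_mul hK] at h1
  have h2 := ENNReal.toReal_mono (hu.lintegral_hardyGrad_lt_top hR hp0 hpb hc ha).ne h1
  rwa [ENNReal.toReal_mul, ENNReal.toReal_ofReal hK] at h2

lemma le_of_forall_mul_setIntegral_hardyPot_le (hn : n ≠ 0) (hR : 0 < R) (hp : 1 < p)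
    (hpb : p ≤ b) (hc : 0 < c) (ha : a < n + 2) (habc : (b - 1) * c ≤ n + 2 - a) {κ : ℝ}
    (hκ : ∀ u : GPt n → ℝ, IsTest {z : GPt n | gNorm z < R} u →
      κ * ∫ z in {z : GPt n | gNorm z < R}, hardyPot p a b c R u z ≤
        ∫ z in {z : GPt n | gNorm z < R}, hardyGrad p a b c R u z) :
    κ ≤ ((b - 1) * c / p) ^ p := by
  have hb : 1 < b := hp.trans_le hpb
  have hp0 : 0 < p := one_pos.trans hp
  have hK₀ : 0 ≤ ((b - 1) * c / p) ^ p :=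
    Real.rpow_nonneg (div_nonneg (mul_nonneg (by linarith) hc.le) hp0.le) _
  refine le_of_forall_gt_imp_ge_of_dense fun K hK => ?_
  have hK0 : 0 ≤ K := hK₀.trans hK.le
  obtain ⟨M, hM0, hM⟩ := exists_abs_deriv_profileBump_le
  obtain ⟨θ, η, hθ, hη, hη1, hle⟩ := exists_cutoff_parameters (c := c) (M := M)
    (A := 6 * 2 ^ (((n : ℝ) + 2 - a) / c)) hp0 hK
  have hu := isTest_gCutoff (n := n) (β := (b - 1) / p) hc hR hη
  have h1 := lintegral_hardyGrad_gCutoff_le hR hp0 hb hc ha hη hη1 hM0 hM hθ hle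
  have h2 := lintegral_hardyPot_gCutoff_pos (p := p) (a := a) (b := b) (β := (b - 1) / p) hn hR hc hη
  have h3 := hu.lintegral_hardyPot_lt_top hR hp hpb hc ha habc
  have h4 := hκ _ hu
  rw [lintegral_ofReal_const_mul hK0] at h1
  have h5 := ENNReal.toReal_mono (ENNReal.mul_ne_top ENNReal.ofReal_ne_top h3.ne) h1
  rw [ENNReal.toReal_mul, ENNReal.toReal_ofReal hK0] at h5
  rw [hu.setIntegral_hardyPot hp0 hc, hu.setIntegral_hardyGrad hp0 hc] at h4
  exact le_of_mul_le_mul_right (h4.trans h5) (ENNReal.toReal_pos h2.ne' h3.ne)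

end Extremal

/-- two-weighted Hardy inequality on the gauge ball with sharp constant
`((b−1)c/p)^p` (Theorem 3.2 of the paper). -/
theorem two_weighted_hardy
    (n : ℕ) (Q : ℝ) (hQ : Q = n + 2) (hQ4 : 4 ≤ Q) (R : ℝ) (hR : 0 < R)
    (p a b c : ℝ) (hp : 1 < p) (ha : a < Q) (hpb : p ≤ b) (hc : 0 < c)
    (habc : a ≤ Q - (b - 1) * c) :
    (∀ u : GPt n → ℝ, IsTest {z : GPt n | gNorm z < R} u →
      (∫ z in {z : GPt n | gNorm z < R},
          gPsi z ^ (p / 2) * |radialDeriv u z| ^ p /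
            (gNorm z ^ (a - p) * (1 - (gNorm z / R) ^ c) ^ (b - p)))
        ≥ ((b - 1) * c / p) ^ p *
            ∫ z in {z : GPt n | gNorm z < R},
              |u z| ^ p * gPsi z ^ (p / 2) /
                (gNorm z ^ a * (1 - (gNorm z / R) ^ c) ^ b))
    ∧ ∀ κ : ℝ,
        (∀ u : GPt n → ℝ, IsTest {z : GPt n | gNorm z < R} u →
          (∫ z in {z : GPt n | gNorm z < R},
              gPsi z ^ (p / 2) * |radialDeriv u z| ^ p /
                (gNorm z ^ (a - p) * (1 - (gNorm z / R) ^ c) ^ (b - p)))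
            ≥ κ *
                ∫ z in {z : GPt n | gNorm z < R},
                  |u z| ^ p * gPsi z ^ (p / 2) /
                    (gNorm z ^ a * (1 - (gNorm z / R) ^ c) ^ b)) →
        κ ≤ ((b - 1) * c / p) ^ p := by
  have hQa : a < n + 2 := hQ ▸ ha
  have hQb : (b - 1) * c ≤ n + 2 - a := by linarith
  have hn : n ≠ 0 := by
    rintro rfl
    norm_num at hQ
    linarith
  exact ⟨fun u hu => hu.mul_setIntegral_hardyPot_le hR hp hpb hc hQa hQb,
    fun κ hκ => le_of_forall_mul_setIntegral_hardyPot_le hn hR hp hpb hc hQa hQb hκ⟩
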